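/- arXiv:2603.02037 — 3 statements merged into one kernel-verified Lean document; each statement's English description precedes it below -/
import Mathlib

section
/- Let A ≻ B be partitions of length at most l and equal weight with |Y(A) \ Y(B)| = k, and let J be a subdivision of {1,…,l}. Then the partition k·G_J(A) + B has positive multiplicity in the power (s_A)^{kL(l)+1} of the Schur function of A. -/
open Finset MvPolynomial

/-- `hp l k` is the complete homogeneous symmetric polynomial `h_k` in `l` variables,
interpreted as `0` for negative `k` (and `h_0 = 1`). -/
noncomputable def hp (l : ℕ) (k : ℤ) : MvPolynomial (Fin l) ℤ :=
  if 0 ≤ k then MvPolynomial.hsymm (Fin l) ℤ k.toNat else 0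

/-- The Schur polynomial of a partition (given as a weakly decreasing `l`-tuple) in `l`
variables, defined by the Jacobi–Trudi determinant `s_A = det (h_{A i - i + j})`. -/
noncomputable def schur (l : ℕ) (A : Fin l → ℕ) : MvPolynomial (Fin l) ℤ :=
  Matrix.det (Matrix.of fun i j : Fin l => hp l ((A i : ℤ) + (j : ℕ) - (i : ℕ)))

/-- The Vandermonde alternant `a_δ = det (x_i ^ (l - 1 - j))`. -/
noncomputable def vdm (l : ℕ) : MvPolynomial (Fin l) ℤ :=
  Matrix.det (Matrix.of fun i j : Fin l => (X i : MvPolynomial (Fin l) ℤ) ^ (l - 1 - (j : ℕ)))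

/-- The multiplicity (coefficient) of the Schur polynomial `s_B` in the expansion of a
symmetric polynomial `P` in the basis of Schur polynomials of partitions of length at most
`l`: it equals the coefficient of the monomial `x ^ (B + δ)` in the alternating polynomial
`P * a_δ`, where `δ = (l-1, l-2, …, 0)`. -/
noncomputable def schurMult (l : ℕ) (B : Fin l → ℕ) (P : MvPolynomial (Fin l) ℤ) : ℤ :=
  MvPolynomial.coeff (Finsupp.equivFunOnFinite.symm fun i : Fin l => B i + (l - 1 - (i : ℕ)))
    (P * vdm l)

/-- The Littlewood–Richardson coefficient `c^C_{A,B}` for partitions of length at most `l`,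
as the multiplicity of `s_C` in `s_A * s_B` (this agrees with the structure constants of the
ring of symmetric functions in the Schur basis). -/
noncomputable def lrCoeff (l : ℕ) (A B C : Fin l → ℕ) : ℤ :=
  schurMult l C (schur l A * schur l B)

/-- Dominance: every partial sum of `A` is at least the corresponding partial sum of `B`. -/
def Dom (l : ℕ) (A B : Fin l → ℕ) : Prop :=
  ∀ r : ℕ, ∑ i ∈ Finset.univ.filter (fun i : Fin l => (i : ℕ) < r), B i ≤
    ∑ i ∈ Finset.univ.filter (fun i : Fin l => (i : ℕ) < r), A i

/-- The Young diagram of `A` (0-based): boxes `(i, j)` with `j < A i`. -/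
def YD (l : ℕ) (A : Fin l → ℕ) : Set (Fin l × ℕ) := {p | p.2 < A p.1}

/-- Size of block `I_j` of the subdivision of `{1,…,l}` encoded by the monotone
surjection `f : Fin l → Fin ι` (whose fibers are the consecutive blocks). -/
def bsize (l ι : ℕ) (f : Fin l → Fin ι) (j : Fin ι) : ℕ :=
  (Finset.univ.filter fun i => f i = j).card

/-- The first (0-based) position of block `I_j`. -/
def bstart (l ι : ℕ) (f : Fin l → Fin ι) (j : Fin ι) : ℕ :=
  (Finset.univ.filter fun i => f i < j).card

/-- One past the last (0-based) position of block `I_j`. -/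
def bend (l ι : ℕ) (f : Fin l → Fin ι) (j : Fin ι) : ℕ :=
  (Finset.univ.filter fun i => f i ≤ j).card

/-- The sum `|A[I_j]|` of the entries of `A` over block `I_j`. -/
def bsum (l ι : ℕ) (f : Fin l → Fin ι) (A : Fin l → ℕ) (j : Fin ι) : ℕ :=
  ∑ i ∈ Finset.univ.filter (fun i => f i = j), A i

/-- `L(l) = lcm {1, …, l}`. -/
def Lnum (l : ℕ) : ℕ := (Finset.Icc 1 l).lcm id

/-- The partition `G_J(A)`: constant on each block `I_j`, with value `(L(l)/|I_j|)·|A[I_j]|`. -/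
def GJ (l ι : ℕ) (f : Fin l → Fin ι) (A : Fin l → ℕ) : Fin l → ℕ :=
  fun i => (Lnum l / bsize l ι f (f i)) * bsum l ι f A (f i)

/-- `A` extended by zero beyond its `l` entries. -/
def pad (l : ℕ) (A : Fin l → ℕ) (m : ℕ) : ℕ := if h : m < l then A ⟨m, h⟩ else 0

/-- The position symmetric to `i` within its block (reversal of the block). -/
def reflIdx (l ι : ℕ) (f : Fin l → Fin ι) (i : Fin l) : ℕ :=
  bstart l ι f (f i) + bend l ι f (f i) - 1 - (i : ℕ)

/-- `χ_J(A)`: on each block, the negatives of the entries of `A` in reversed order. -/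
def chiJ (l ι : ℕ) (f : Fin l → Fin ι) (A : Fin l → ℕ) : Fin l → ℤ :=
  fun i => -(pad l A (reflIdx l ι f i) : ℤ)

/-! ### Part 1: alternants and the Pieri rule -/

/-- Rows are encoded as functions `ℕ → ℕ`; `IsP l μ` says `μ` is a partition with at most `l`
parts. -/
def IsP (l : ℕ) (μ : ℕ → ℕ) : Prop := Antitone μ ∧ ∀ i, l ≤ i → μ i = 0

/-- The alternant with arbitrary exponents. -/
noncomputable def alt (l : ℕ) (ν : Fin l → ℕ) : MvPolynomial (Fin l) ℤ :=
  Matrix.det (Matrix.of fun i j : Fin l => (X i : MvPolynomial (Fin l) ℤ) ^ (ν j))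

/-- The alternant `a_{μ+δ}`. -/
noncomputable def al (l : ℕ) (μ : ℕ → ℕ) : MvPolynomial (Fin l) ℤ :=
  alt l fun j => μ j + (l - 1 - (j : ℕ))

lemma vdm_eq (l : ℕ) : vdm l = al l (fun _ => 0) := by
  simp [vdm, al, alt]

lemma alt_swap (l : ℕ) (ν ν' : Fin l → ℕ) (a b : Fin l) (hab : a ≠ b)
    (h : ν' = ν ∘ Equiv.swap a b) : alt l ν' = - alt l ν := by
  subst h
  have := Matrix.det_permute' (Equiv.swap a b)
    (Matrix.of fun i j : Fin l => (X i : MvPolynomial (Fin l) ℤ) ^ (ν j))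
  rw [Equiv.Perm.sign_swap hab] at this
  simp only [Units.val_neg, Units.val_one, Int.cast_neg, Int.cast_one, neg_mul, one_mul] at this
  exact this

lemma alt_zero (l : ℕ) (ν : Fin l → ℕ) (a b : Fin l) (hab : a ≠ b)
    (h : ν a = ν b) : alt l ν = 0 := by
  apply Matrix.det_zero_of_column_eq hab
  intro k
  simp [h]

lemma hsymm_eq (l n : ℕ) : hsymm (Fin l) ℤ n =
    ∑ β ∈ Finset.piAntidiag (Finset.univ : Finset (Fin l)) n,
      ∏ j, (X j : MvPolynomial (Fin l) ℤ) ^ β j := by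
  rw [hsymm]
  refine Finset.sum_bij (fun s _ => fun a => (s : Multiset (Fin l)).count a) ?_ ?_ ?_ ?_
  · intro s _
    simp
  · intro s _ t _ h
    apply Sym.coe_injective
    ext a
    exact congrFun h a
  · intro β hβ
    simp only [Finset.mem_piAntidiag, Finset.mem_univ, implies_true, and_true] at hβ
    refine ⟨(Sym.equivNatSumOfFintype (Fin l) n).symm ⟨β, hβ⟩, Finset.mem_univ _, ?_⟩
    funext a
    rw [← Sym.coe_equivNatSumOfFintype_apply_apply]
    simp
  · intro s _
    exact Finset.prod_multiset_map_count _ _ |>.trans (by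
      apply Finset.prod_subset (Finset.subset_univ _)
      intro x _ hx
      rw [Multiset.mem_toFinset] at hx
      rw [Multiset.count_eq_zero_of_notMem hx, pow_zero])

lemma hsymm_mul_alt (l n : ℕ) (ν : Fin l → ℕ) : hsymm (Fin l) ℤ n * alt l ν =
    ∑ β ∈ Finset.piAntidiag (Finset.univ : Finset (Fin l)) n, alt l (ν + β) := by
  simp only [alt, Matrix.det_apply, Matrix.of_apply]
  rw [Finset.sum_comm, Finset.mul_sum]
  refine Finset.sum_congr rfl fun σ _ => ?_
  rw [← Finset.smul_sum, mul_smul_comm]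
  congr 1
  conv_lhs => rw [← rename_hsymm (Fin l) ℤ n σ, hsymm_eq]
  rw [map_sum, Finset.sum_mul]
  refine Finset.sum_congr rfl fun β _ => ?_
  simp only [map_prod, map_pow, rename_X, Pi.add_apply, pow_add, Finset.prod_mul_distrib]
  ring

lemma finite_bdd (l K : ℕ) : {μ : ℕ → ℕ | (∀ i, l ≤ i → μ i = 0) ∧ ∀ i, μ i ≤ K}.Finite := by
  apply Set.Finite.subset (Set.finite_range
    (fun g : Fin l → Fin (K + 1) => fun i : ℕ => if h : i < l then ((g ⟨i, h⟩ : Fin (K+1)) : ℕ) else 0))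
  rintro μ ⟨h1, h2⟩
  refine ⟨fun i => ⟨μ i, by have := h2 i; omega⟩, ?_⟩
  funext i
  by_cases h : i < l
  · simp [h]
  · simp [h, h1 i (by omega)]

/-- `μ` extends `lam` by `n` boxes, within the first `l` rows. -/
def RExt (l : ℕ) (lam : ℕ → ℕ) (n : ℤ) (μ : ℕ → ℕ) : Prop :=
  (∀ i, lam i ≤ μ i) ∧ (∀ i, l ≤ i → μ i = 0) ∧
    ((∑ i ∈ range l, μ i : ℕ) : ℤ) = (∑ i ∈ range l, lam i : ℕ) + n

/-- horizontal strips -/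
def Strip (l : ℕ) (lam : ℕ → ℕ) (n : ℤ) (μ : ℕ → ℕ) : Prop :=
  RExt l lam n μ ∧ ∀ i, μ (i + 1) ≤ lam i

lemma ext_finite (l : ℕ) (lam : ℕ → ℕ) (n : ℤ) : {μ | RExt l lam n μ}.Finite := by
  apply (finite_bdd l (∑ i ∈ range l, lam i + n.toNat)).subset
  rintro μ ⟨h1, h2, h3⟩
  refine ⟨h2, fun i => ?_⟩
  by_cases h : i < l
  · have := Finset.single_le_sum (f := μ) (fun _ _ => Nat.zero_le _) (Finset.mem_range.2 h)
    omega
  · simp [h2 i (by omega)]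

lemma strip_finite (l : ℕ) (lam : ℕ → ℕ) (n : ℤ) : {μ | Strip l lam n μ}.Finite :=
  (ext_finite l lam n).subset fun _ h => h.1

noncomputable def extF (l : ℕ) (lam : ℕ → ℕ) (n : ℤ) : Finset (ℕ → ℕ) := (ext_finite l lam n).toFinset
noncomputable def stripF (l : ℕ) (lam : ℕ → ℕ) (n : ℤ) : Finset (ℕ → ℕ) :=
  (strip_finite l lam n).toFinset

lemma mem_extF {l lam n μ} : μ ∈ extF l lam n ↔ RExt l lam n μ := by simp [extF]
lemma mem_stripF {l lam n μ} : μ ∈ stripF l lam n ↔ Strip l lam n μ := by simp [stripF]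

lemma pieri_raw (l : ℕ) (lam : ℕ → ℕ) (hlam : ∀ i, l ≤ i → lam i = 0) (n : ℤ) :
    hp l n * al l lam = ∑ μ ∈ extF l lam n, al l μ := by
  rw [hp]
  split_ifs with hn
  · rw [al, hsymm_mul_alt]
    refine Finset.sum_bij' (fun β _ => fun i => lam i + if h : i < l then β ⟨i, h⟩ else 0)
      (fun μ _ => fun j => μ j - lam j) ?_ ?_ ?_ ?_ ?_
    · intro β hβ
      simp only [Finset.mem_piAntidiag, Finset.mem_univ, implies_true, and_true] at hβ
      rw [mem_extF]
      refine ⟨fun i => by simp, fun i hi => by simp [hlam i hi, hi], ?_⟩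
      rw [Finset.sum_add_distrib]
      have : ∑ x ∈ range l, (if h : x < l then β ⟨x, h⟩ else 0) = n.toNat := by
        rw [← hβ, Finset.sum_range]
        simp
      rw [this]
      push_cast
      omega
    · intro μ hμ
      rw [mem_extF] at hμ
      obtain ⟨h1, h2, h3⟩ := hμ
      simp only [Finset.mem_piAntidiag, Finset.mem_univ, implies_true, and_true]
      have : ∑ j : Fin l, (μ j - lam j) + ∑ j : Fin l, lam j = ∑ j : Fin l, μ j := by
        rw [← Finset.sum_add_distrib]
        exact Finset.sum_congr rfl fun j _ => Nat.sub_add_cancel (h1 j)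
      rw [Finset.sum_range, Finset.sum_range] at h3
      omega
    · intro β hβ
      funext j
      simp
    · intro μ hμ
      rw [mem_extF] at hμ
      obtain ⟨h1, h2, h3⟩ := hμ
      funext i
      by_cases h : i < l
      · simp [h, h1 i]
      · simp [h, h2 i (by omega), hlam i (by omega)]
    · intro β hβ
      rw [al]
      congr 1
      funext j
      simp
      ring
  · rw [zero_mul, Finset.sum_eq_zero]
    intro μ hμ
    rw [mem_extF] at hμ
    obtain ⟨h1, h2, h3⟩ := hμ
    have := Finset.sum_le_sum (s := range l) (fun i _ => h1 i)
    omega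

/-- the swap in the proof of Pieri's rule -/
def pswap (i : ℕ) (μ : ℕ → ℕ) : ℕ → ℕ := fun j =>
  if j = i then μ (i + 1) - 1 else if j = i + 1 then μ i + 1 else μ j

lemma al_pswap (l i : ℕ) (μ : ℕ → ℕ) (hi : i + 1 < l) (hμ : 0 < μ (i + 1)) :
    al l (pswap i μ) = - al l μ := by
  apply alt_swap l _ _ ⟨i, by omega⟩ ⟨i + 1, hi⟩ (by simp)
  funext j
  simp only [Function.comp, pswap, Equiv.swap_apply_def, Fin.ext_iff]
  split_ifs <;> simp <;> omega

lemma sum_pswap (l i : ℕ) (μ : ℕ → ℕ) (hi : i + 1 < l) (hμ : 0 < μ (i + 1)) :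
    ∑ j ∈ range l, pswap i μ j = ∑ j ∈ range l, μ j := by
  have h1 : ∀ g : ℕ → ℕ, ∑ j ∈ range l, g j = g i + (g (i + 1) +
      ∑ j ∈ ((range l).erase i).erase (i + 1), g j) := by
    intro g
    rw [Finset.add_sum_erase, Finset.add_sum_erase] <;> simp <;> omega
  rw [h1, h1 μ]
  have : ∑ j ∈ ((range l).erase i).erase (i + 1), pswap i μ j =
      ∑ j ∈ ((range l).erase i).erase (i + 1), μ j := by
    refine Finset.sum_congr rfl fun j hj => ?_
    simp at hj
    simp [pswap, hj.1, hj.2.1]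
  rw [this]
  simp [pswap]
  omega

/-- `i` is the last violation of the strip condition. -/
def LastV (l : ℕ) (lam μ : ℕ → ℕ) (i : ℕ) : Prop :=
  lam i < μ (i + 1) ∧ ∀ j, i < j → μ (j + 1) ≤ lam j

lemma lastV_exists (l : ℕ) (lam μ : ℕ → ℕ) (n : ℤ) (h : RExt l lam n μ) (hs : ¬ Strip l lam n μ) :
    ∃ i, i + 1 < l ∧ LastV l lam μ i := by
  have hex : ∃ i, lam i < μ (i + 1) := by
    by_contra hc
    push Not at hc
    exact hs ⟨h, hc⟩
  obtain ⟨i, hi⟩ := hex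
  have hb : ∀ i, lam i < μ (i + 1) → i + 1 < l := by
    intro i hi
    by_contra hc
    have := h.2.1 (i + 1) (by omega)
    omega
  classical
  let k := Nat.findGreatest (fun i => lam i < μ (i + 1)) l
  have hk : lam k < μ (k + 1) :=
    Nat.findGreatest_spec (P := fun i => lam i < μ (i + 1)) (m := i) (by have := hb i hi; omega) hi
  refine ⟨k, hb k hk, hk, fun j hj => ?_⟩
  by_contra hc
  push Not at hc
  have := Nat.le_findGreatest (P := fun i => lam i < μ (i + 1)) (n := l) (m := j)
    (by have := hb j hc; omega) hc
  omega

lemma lastV_unique {l : ℕ} {lam μ : ℕ → ℕ} {i j : ℕ} (hi : LastV l lam μ i)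
    (hj : LastV l lam μ j) : i = j := by
  rcases lt_trichotomy i j with h | h | h
  · have := hi.2 j h; have := hj.1; omega
  · exact h
  · have := hj.2 i h; have := hi.1; omega

lemma pieri (l : ℕ) (lam : ℕ → ℕ) (hlam : IsP l lam) (n : ℤ) :
    hp l n * al l lam = ∑ μ ∈ stripF l lam n, al l μ := by
  classical
  rw [pieri_raw l lam hlam.2, ← Finset.sum_filter_add_sum_filter_not _ (fun μ => Strip l lam n μ)]
  have e1 : (extF l lam n).filter (fun μ => Strip l lam n μ) = stripF l lam n := by
    ext μ
    simp only [Finset.mem_filter, mem_extF, mem_stripF]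
    exact ⟨fun h => h.2, fun h => ⟨h.1, h⟩⟩
  rw [e1]
  convert add_zero _
  have key : ∀ μ, μ ∈ (extF l lam n).filter (fun μ => ¬ Strip l lam n μ) →
      ∃ i, i + 1 < l ∧ LastV l lam μ i := by
    intro μ hμ
    simp only [Finset.mem_filter, mem_extF] at hμ
    exact lastV_exists l lam μ n hμ.1 hμ.2
  choose! I hI using key
  have hlast : ∀ μ, ∀ i, lam i ≤ μ i → LastV l lam μ i → LastV l lam (pswap i μ) i := by
    intro μ i hle h
    have hh := h.1
    refine ⟨?_, fun j hj => ?_⟩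
    · simp only [pswap]
      simp
      omega
    · have := h.2 j hj
      simp only [pswap]
      split_ifs <;> omega
  have hmem : ∀ μ ∈ (extF l lam n).filter (fun μ => ¬ Strip l lam n μ),
      pswap (I μ) μ ∈ (extF l lam n).filter (fun μ => ¬ Strip l lam n μ) := by
    intro μ hμ
    obtain ⟨h1, h2⟩ := hI μ hμ
    simp only [Finset.mem_filter, mem_extF] at hμ ⊢
    refine ⟨⟨fun j => ?_, fun j hj => ?_, ?_⟩, fun hs => ?_⟩
    · have a1 := hμ.1.1 j
      have a2 := hμ.1.1 (I μ)
      have a3 := h2.1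
      have := hlam.1 (Nat.le_succ (I μ))
      simp only [pswap]
      split_ifs with c1 c2
      · subst c1; omega
      · subst c2; simp at *; omega
      · exact a1
    · simp only [pswap]
      rw [if_neg (by omega), if_neg (by omega)]
      exact hμ.1.2.1 j hj
    · rw [sum_pswap l _ μ h1 (by have := h2.1; omega)]
      exact hμ.1.2.2
    · have := (hlast μ _ (hμ.1.1 _) h2).1
      have := hs.2 (I μ)
      omega
  refine Finset.sum_involution (fun μ _ => pswap (I μ) μ) ?_ ?_ ?_ ?_
  · intro μ hμ
    obtain ⟨h1, h2⟩ := hI μ hμ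
    rw [al_pswap l _ μ h1 (by have := h2.1; omega)]
    ring
  · intro μ hμ h0 he
    obtain ⟨h1, h2⟩ := hI μ hμ
    have := al_pswap l _ μ h1 (by have := h2.1; omega)
    rw [he] at this
    exact h0 (self_eq_neg.1 this)
  · exact hmem
  · intro μ hμ
    obtain ⟨h1, h2⟩ := hI μ hμ
    have hle := (mem_extF.1 (Finset.mem_filter.1 hμ).1).1 (I μ)
    obtain ⟨h1', h2'⟩ := hI _ (hmem μ hμ)
    have e := lastV_unique h2' (hlast μ _ hle h2)
    rw [e]
    have := h2.1
    funext j
    simp only [pswap]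
    split_ifs with c1 c2 <;> simp_all <;> omega

/-! ### Part 2: chains of strips and the Littlewood–Richardson cancellation -/

lemma strip_isP {l : ℕ} {lam μ : ℕ → ℕ} {n : ℤ} (h : Strip l lam n μ) : IsP l μ :=
  ⟨antitone_nat_of_succ_le fun i => (h.2 i).trans (h.1.1 i), h.1.2.1⟩

/-- A chain of `m` horizontal strips starting at `lam`, with sizes `α`. -/
def IsChain' (l m : ℕ) (α : ℕ → ℤ) (lam : ℕ → ℕ) (Λ : ℕ → ℕ → ℕ) : Prop :=
  Λ 0 = lam ∧ (∀ r, r < m → Strip l (Λ r) (α r) (Λ (r + 1))) ∧ ∀ r, m ≤ r → Λ r = Λ m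

lemma chain_isP {l m : ℕ} {α : ℕ → ℤ} {lam : ℕ → ℕ} {Λ : ℕ → ℕ → ℕ} (hlam : IsP l lam)
    (h : IsChain' l m α lam Λ) (r : ℕ) : IsP l (Λ r) := by
  have key : ∀ r, r ≤ m → IsP l (Λ r) := by
    intro r hr
    cases r with
    | zero => rw [h.1]; exact hlam
    | succ r => exact strip_isP (h.2.1 r hr)
  rcases le_total r m with h' | h'
  · exact key r h'
  · rw [h.2.2 r h']; exact key m le_rfl

lemma chain_sum (l : ℕ) (α : ℕ → ℤ) (lam : ℕ → ℕ) (hlam : IsP l lam) (m : ℕ) :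
    ∃ S : Finset (ℕ → ℕ → ℕ), (∀ Λ, Λ ∈ S ↔ IsChain' l m α lam Λ) ∧
      (∏ r ∈ range m, hp l (α r)) * al l lam = ∑ Λ ∈ S, al l (Λ m) := by
  classical
  induction m with
  | zero =>
    refine ⟨{fun _ => lam}, fun Λ => ?_, by simp⟩
    simp only [Finset.mem_singleton, IsChain']
    constructor
    · rintro rfl; simp
    · rintro ⟨h1, -, h3⟩
      funext r
      rw [h3 r (Nat.zero_le _), h1]
  | succ m ih =>
    obtain ⟨S, hS, hsum⟩ := ih
    let g : (Σ _ : (ℕ → ℕ → ℕ), (ℕ → ℕ)) → (ℕ → ℕ → ℕ) := fun p r => if r ≤ m then p.1 r else p.2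
    have hmem : ∀ Λ, IsChain' l (m + 1) α lam Λ ↔
        ∃ p ∈ S.sigma (fun Λ => stripF l (Λ m) (α m)), g p = Λ := by
      intro Λ
      constructor
      · rintro ⟨h1, h2, h3⟩
        refine ⟨⟨fun r => if r ≤ m then Λ r else Λ m, Λ (m + 1)⟩, ?_, ?_⟩
        · simp only [Finset.mem_sigma, hS, mem_stripF]
          refine ⟨⟨by simpa using h1, fun r hr => ?_, fun r hr => ?_⟩, ?_⟩
          · simpa [hr.le, Nat.succ_le_of_lt hr] using h2 r (by omega)
          · simp
            intro h
            rw [le_antisymm h hr]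
          · simpa using h2 m (by omega)
        · funext r
          simp only [g]
          split_ifs with h
          · rfl
          · rw [h3 r (by omega)]
      · rintro ⟨⟨Λ', μ⟩, hp, rfl⟩
        simp only [Finset.mem_sigma, hS, mem_stripF] at hp
        obtain ⟨⟨h1, h2, h3⟩, h4⟩ := hp
        refine ⟨by simpa [g] using h1, fun r hr => ?_, fun r hr => ?_⟩
        · rcases Nat.lt_succ_iff_lt_or_eq.1 hr with h | h
          · simpa [g, h.le, Nat.succ_le_of_lt h] using h2 r h
          · subst h
            simpa [g] using h4
        · simp only [g]
          rw [if_neg (by omega), if_neg (by omega)]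
    have hinj : ∀ p ∈ S.sigma (fun Λ => stripF l (Λ m) (α m)),
        ∀ q ∈ S.sigma (fun Λ => stripF l (Λ m) (α m)), g p = g q → p = q := by
      rintro ⟨Λ, μ⟩ hp ⟨Λ', μ'⟩ hq h
      simp only [Finset.mem_sigma, hS, mem_stripF] at hp hq
      have e1 : Λ = Λ' := by
        funext r
        have h0 : ∀ r, r ≤ m → Λ r = Λ' r := by
          intro r hr
          have := congrFun h r
          simpa [g, hr] using this
        rcases le_total r m with h' | h'
        · exact h0 r h'
        · rw [hp.1.2.2 r h', hq.1.2.2 r h', h0 m le_rfl]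
      have e2 : μ = μ' := by
        have := congrFun h (m + 1)
        simpa [g] using this
      rw [e1, e2]
    refine ⟨(S.sigma (fun Λ => stripF l (Λ m) (α m))).image g, fun Λ => ?_, ?_⟩
    · rw [Finset.mem_image, hmem]
    · rw [Finset.sum_image hinj, Finset.sum_sigma, Finset.prod_range_succ, mul_right_comm, hsum,
        Finset.sum_mul]
      refine Finset.sum_congr rfl fun Λ hΛ => ?_
      rw [mul_comm, pieri l _ (chain_isP hlam ((hS Λ).1 hΛ) m)]
      refine Finset.sum_congr rfl fun μ hμ => ?_
      simp [g]

/-- partial sums -/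
def ps (μ : ℕ → ℕ) (i : ℕ) : ℕ := ∑ j ∈ range i, μ j

lemma ps_succ (μ : ℕ → ℕ) (i : ℕ) : ps μ (i + 1) = ps μ i + μ i := Finset.sum_range_succ _ _
lemma ps_zero (μ : ℕ → ℕ) : ps μ 0 = 0 := rfl
lemma ps_congr {μ ν : ℕ → ℕ} {i : ℕ} (h : ∀ j, j < i → μ j = ν j) : ps μ i = ps ν i :=
  Finset.sum_congr rfl fun j hj => h j (Finset.mem_range.1 hj)

/-- failure of the lattice condition for three consecutive rows -/
def F3 (ρ lam τ : ℕ → ℕ) (i : ℕ) : Prop := ps lam (i + 1) + ps lam i < ps τ (i + 1) + ps ρ i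

/-- the threshold at the failing row -/
def thr (ρ lam τ : ℕ → ℕ) (i : ℕ) : ℕ := ps τ (i + 1) + ps ρ i - 2 * ps lam i - 1

/-- the truncated Bender–Knuth reflection of the middle row -/
def refl3 (ρ lam τ : ℕ → ℕ) (i : ℕ) : ℕ → ℕ := fun j =>
  if j < i then lam j
  else if j = i then thr ρ lam τ i + max (ρ i) (τ (i + 1)) - lam i
  else min (ρ (j - 1)) (τ j) + max (ρ j) (τ (j + 1)) - lam j

/-- All structural conditions on three rows. -/
structure S3 (ρ lam τ : ℕ → ℕ) : Prop where
  h1 : ∀ j, ρ j ≤ lam j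
  h2 : ∀ j, lam (j + 1) ≤ ρ j
  h3 : ∀ j, lam j ≤ τ j
  h4 : ∀ j, τ (j + 1) ≤ lam j

section three
variable {ρ lam τ : ℕ → ℕ} {i : ℕ}

lemma F3_iff : F3 ρ lam τ i ↔ 2 * ps lam i + lam i + 1 ≤ ps τ (i + 1) + ps ρ i := by
  rw [F3, ps_succ lam]; omega

lemma F3_thr (h : F3 ρ lam τ i) : thr ρ lam τ i + 2 * ps lam i + 1 = ps τ (i + 1) + ps ρ i ∧
    lam i ≤ thr ρ lam τ i := by
  rw [F3_iff] at h
  unfold thr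
  omega

lemma thr_lt (s : S3 ρ lam τ) (h : F3 ρ lam τ i) (hp : ∀ j, j < i → ¬ F3 ρ lam τ j) :
    thr ρ lam τ i < τ i ∧ ∀ k, i = k + 1 → thr ρ lam τ i ≤ ρ k := by
  have ht := F3_thr h
  cases i with
  | zero =>
    simp only [ps_zero, ps_succ] at ht
    refine ⟨by omega, fun k hk => by omega⟩
  | succ k =>
    have hk := hp k (by omega)
    rw [F3_iff] at hk
    have a1 := s.h1 k
    have a4 := s.h4 k
    rw [ps_succ τ (k+1), ps_succ ρ, ps_succ lam] at ht
    refine ⟨by omega, fun k' hk' => ?_⟩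
    obtain rfl : k = k' := by omega
    omega

lemma refl3_lt {j : ℕ} (hj : j < i) : refl3 ρ lam τ i j = lam j := by simp [refl3, hj]

lemma refl3_ps {j : ℕ} (hj : j ≤ i) : ps (refl3 ρ lam τ i) j = ps lam j :=
  ps_congr fun k hk => refl3_lt (by omega)

lemma refl3_S3 (s : S3 ρ lam τ) (h : F3 ρ lam τ i) (hp : ∀ j, j < i → ¬ F3 ρ lam τ j) :
    S3 ρ (refl3 ρ lam τ i) τ := by
  have ht := F3_thr h
  obtain ⟨t1, t2⟩ := thr_lt s h hp
  have main : ∀ j, ρ j ≤ refl3 ρ lam τ i j ∧ τ (j + 1) ≤ refl3 ρ lam τ i j ∧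
      refl3 ρ lam τ i j ≤ τ j ∧ ∀ k, j = k + 1 → refl3 ρ lam τ i j ≤ ρ k := by
    intro j
    have a1 := s.h1 j
    have a3 := s.h3 j
    have a4 := s.h4 j
    unfold refl3
    split_ifs with c1 c2
    · refine ⟨a1, a4, a3, ?_⟩
      rintro k rfl
      exact s.h2 k
    · subst c2
      refine ⟨by omega, by omega, by omega, ?_⟩
      intro k hk
      have := t2 k hk
      omega
    · obtain ⟨k, rfl⟩ : ∃ k, j = k + 1 := ⟨j - 1, by omega⟩
      have a2 := s.h2 k
      simp only [Nat.add_sub_cancel]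
      refine ⟨by omega, by omega, by omega, ?_⟩
      intro k' hk'
      obtain rfl : k = k' := by omega
      omega
  exact ⟨fun j => (main j).1, fun j => (main (j + 1)).2.2.2 j rfl, fun j => (main j).2.2.1,
    fun j => (main j).2.1⟩

lemma refl3_thr : thr ρ (refl3 ρ lam τ i) τ i = thr ρ lam τ i := by
  unfold thr
  rw [refl3_ps le_rfl]

lemma refl3_F3 (s : S3 ρ lam τ) (h : F3 ρ lam τ i) :
    F3 ρ (refl3 ρ lam τ i) τ i := by
  have ht := F3_thr h
  rw [F3_iff, refl3_ps le_rfl]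
  have a1 := s.h1 i
  have a4 := s.h4 i
  have : refl3 ρ lam τ i i ≤ thr ρ lam τ i := by
    simp only [refl3, lt_irrefl, if_true, if_false]
    omega
  omega

lemma refl3_refl3 (s : S3 ρ lam τ) (h : F3 ρ lam τ i) :
    refl3 ρ (refl3 ρ lam τ i) τ i = lam := by
  have ht := F3_thr h
  funext j
  have a1 := s.h1 j
  have a3 := s.h3 j
  have a4 := s.h4 j
  rcases lt_trichotomy j i with c | c | c
  · rw [refl3_lt c, refl3_lt c]
  · subst c
    rw [refl3, if_neg (lt_irrefl _), if_pos rfl, refl3_thr]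
    simp only [refl3, lt_irrefl, if_true, if_false]
    omega
  · rw [refl3, if_neg (by omega), if_neg (by omega), refl3, if_neg (by omega), if_neg (by omega)]
    obtain ⟨k, rfl⟩ : ∃ k, j = k + 1 := ⟨j - 1, by omega⟩
    have a2 := s.h2 k
    simp only [Nat.add_sub_cancel]
    omega

lemma refl3_sum_aux (s : S3 ρ lam τ) (h : F3 ρ lam τ i) (n : ℕ) :
    ps (refl3 ρ lam τ i) (i + 1 + n) + ps lam (i + 1 + n) + 1 =
      ps τ (i + 1 + n) + ps ρ (i + n) + max (ρ (i + n)) (τ (i + n + 1)) := by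
  induction n with
  | zero =>
    have ht := F3_thr h
    have a1 := s.h1 i
    have a4 := s.h4 i
    simp only [add_zero]
    rw [ps_succ lam, ps_succ (refl3 _ _ _ _), refl3_ps le_rfl]
    simp only [refl3, lt_irrefl, if_true, if_false]
    omega
  | succ n ih =>
    have e : i + 1 + (n + 1) = (i + 1 + n) + 1 := by ring
    have e' : i + (n + 1) = i + n + 1 := by ring
    have e'' : i + n + 1 = i + 1 + n := by ring
    rw [e, e', ps_succ lam, ps_succ (refl3 _ _ _ _), ps_succ τ, ps_succ ρ]
    have a1 := s.h1 (i + 1 + n)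
    have a2 := s.h2 (i + n)
    have a3 := s.h3 (i + 1 + n)
    have a4 := s.h4 (i + 1 + n)
    have : refl3 ρ lam τ i (i + 1 + n) = min (ρ (i + n)) (τ (i + 1 + n)) +
        max (ρ (i + 1 + n)) (τ (i + 1 + n + 1)) - lam (i + 1 + n) := by
      rw [refl3, if_neg (by omega), if_neg (by omega), show i + 1 + n - 1 = i + n by omega]
    rw [this]
    rw [e''] at ih a2 ⊢
    omega

lemma refl3_sum {l : ℕ} (hi : i < l) (s : S3 ρ lam τ) (h : F3 ρ lam τ i) (hτ : τ l = 0) :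
    ps (refl3 ρ lam τ i) l + ps lam l + 1 = ps τ l + ps ρ l := by
  obtain ⟨n, rfl⟩ : ∃ n, l = i + n + 1 := ⟨l - i - 1, by omega⟩
  have := refl3_sum_aux s h n
  rw [hτ] at this
  rw [ps_succ ρ, show i + n + 1 = i + 1 + n by ring]
  omega

lemma refl3_supp {l : ℕ} (hi : i < l) (s : S3 ρ lam τ) (hτ : ∀ j, l ≤ j → τ j = 0) :
    ∀ j, l ≤ j → refl3 ρ lam τ i j = 0 := by
  intro j hj
  have b1 := hτ j hj
  have b2 := hτ (j + 1) (by omega)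
  have a1 := s.h1 j
  have a3 := s.h3 j
  rw [refl3, if_neg (by omega), if_neg (by omega)]
  omega

end three

/-- the contents appearing in the Jacobi–Trudi expansion -/
def cont (l : ℕ) (A : Fin l → ℕ) (σ : Equiv.Perm (Fin l)) (r : ℕ) : ℤ :=
  if h : r < l then (A (σ ⟨r, h⟩) : ℤ) + r - (σ ⟨r, h⟩ : ℕ) else 0

/-- lattice condition -/
def LatC (l : ℕ) (Λ : ℕ → ℕ → ℕ) : Prop :=
  ∀ r i, r + 2 ≤ l → i < l → ¬ F3 (Λ r) (Λ (r + 1)) (Λ (r + 2)) i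

/-- the distinguished first failure of the lattice condition -/
def FF (l : ℕ) (Λ : ℕ → ℕ → ℕ) (r i : ℕ) : Prop :=
  (r + 2 ≤ l ∧ i < l ∧ F3 (Λ r) (Λ (r + 1)) (Λ (r + 2)) i) ∧
  (∀ i', i' < i → ∀ r', r' + 2 ≤ l → ¬ F3 (Λ r') (Λ (r' + 1)) (Λ (r' + 2)) i') ∧
  ∀ r', r < r' → r' + 2 ≤ l → ¬ F3 (Λ r') (Λ (r' + 1)) (Λ (r' + 2)) i

lemma FF_exists {l : ℕ} {Λ : ℕ → ℕ → ℕ} (h : ¬ LatC l Λ) : ∃ r i, FF l Λ r i := by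
  classical
  have hex : ∃ i, i < l ∧ ∃ r, r + 2 ≤ l ∧ F3 (Λ r) (Λ (r + 1)) (Λ (r + 2)) i := by
    by_contra hc
    push Not at hc
    exact h fun r i h1 h2 => hc i h2 r h1
  obtain ⟨h1, r1, h2, h3⟩ := Nat.find_spec hex
  set i := Nat.find hex with hi
  let P : ℕ → Prop := fun r => r + 2 ≤ l ∧ F3 (Λ r) (Λ (r + 1)) (Λ (r + 2)) i
  have hP : P (Nat.findGreatest P l) := Nat.findGreatest_spec (m := r1) (by omega) ⟨h2, h3⟩
  refine ⟨Nat.findGreatest P l, i, ⟨hP.1, h1, hP.2⟩, fun i' hi' r' hr' hF => ?_,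
    fun r' hr' hl' hF => ?_⟩
  · exact Nat.find_min hex hi' ⟨by omega, r', hr', hF⟩
  · have := Nat.le_findGreatest (P := P) (n := l) (m := r') (by omega) ⟨hl', hF⟩
    omega

lemma FF_unique {l : ℕ} {Λ : ℕ → ℕ → ℕ} {r i r' i' : ℕ} (h : FF l Λ r i) (h' : FF l Λ r' i') :
    r = r' ∧ i = i' := by
  have e : i = i' := by
    rcases lt_trichotomy i i' with c | c | c
    · exact absurd h.1.2.2 (h'.2.1 i c r h.1.1)
    · exact c
    · exact absurd h'.1.2.2 (h.2.1 i' c r' h'.1.1)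
  subst e
  refine ⟨?_, rfl⟩
  rcases lt_trichotomy r r' with c | c | c
  · exact absurd h'.1.2.2 (h.2.2 r' c h'.1.1)
  · exact c
  · exact absurd h.1.2.2 (h'.2.2 r c h.1.1)

/-- the sign-reversing involution -/
def newL (Λ : ℕ → ℕ → ℕ) (r i : ℕ) : ℕ → ℕ → ℕ :=
  Function.update Λ (r + 1) (refl3 (Λ r) (Λ (r + 1)) (Λ (r + 2)) i)

lemma newL_ne {Λ : ℕ → ℕ → ℕ} {r i s : ℕ} (h : s ≠ r + 1) : newL Λ r i s = Λ s :=
  Function.update_of_ne h _ _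

lemma newL_eq {Λ : ℕ → ℕ → ℕ} {r i : ℕ} :
    newL Λ r i (r + 1) = refl3 (Λ r) (Λ (r + 1)) (Λ (r + 2)) i :=
  Function.update_self _ _ _

lemma chain_S3 {l m : ℕ} {α : ℕ → ℤ} {lam : ℕ → ℕ} {Λ : ℕ → ℕ → ℕ}
    (h : IsChain' l m α lam Λ) {r : ℕ} (hr : r + 2 ≤ m) :
    S3 (Λ r) (Λ (r + 1)) (Λ (r + 2)) :=
  ⟨(h.2.1 r (by omega)).1.1, (h.2.1 r (by omega)).2, (h.2.1 (r + 1) (by omega)).1.1,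
    (h.2.1 (r + 1) (by omega)).2⟩

lemma F3_congr {ρ lam τ ρ' lam' τ' : ℕ → ℕ} {i : ℕ} (h1 : ps ρ i = ps ρ' i)
    (h2 : ps lam i = ps lam' i) (h3 : ps lam (i + 1) = ps lam' (i + 1))
    (h4 : ps τ (i + 1) = ps τ' (i + 1)) : F3 ρ lam τ i ↔ F3 ρ' lam' τ' i := by
  rw [F3, F3, h1, h2, h3, h4]

lemma newL_ps {Λ : ℕ → ℕ → ℕ} {r i s j : ℕ} (hj : j ≤ i) : ps (newL Λ r i s) j = ps (Λ s) j := by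
  by_cases h : s = r + 1
  · subst h
    rw [newL_eq, refl3_ps hj]
  · rw [newL_ne h]

lemma newL_FF {l m : ℕ} {α : ℕ → ℤ} {lam : ℕ → ℕ} {Λ : ℕ → ℕ → ℕ} {r i : ℕ}
    (h : IsChain' l m α lam Λ) (hm : m = l) (hF : FF l Λ r i) : FF l (newL Λ r i) r i := by
  subst hm
  obtain ⟨⟨h1, h2, h3⟩, h4, h5⟩ := hF
  have s := chain_S3 h h1
  refine ⟨⟨h1, h2, ?_⟩, fun i' hi' r' hr' => ?_, fun r' hr hr' => ?_⟩
  · rw [newL_eq, newL_ne (by omega), newL_ne (by omega)]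
    exact refl3_F3 s h3
  · rw [F3_congr (newL_ps hi'.le) (newL_ps hi'.le) (newL_ps (by omega)) (newL_ps (by omega))]
    exact h4 i' hi' r' hr'
  · rw [F3_congr (newL_ps le_rfl) (newL_ps le_rfl) (by rw [newL_ne (by omega)])
      (by rw [newL_ne (by omega)])]
    exact h5 r' hr hr'

lemma newL_newL {l m : ℕ} {α : ℕ → ℤ} {lam : ℕ → ℕ} {Λ : ℕ → ℕ → ℕ} {r i : ℕ}
    (h : IsChain' l m α lam Λ) (hm : m = l) (hF : FF l Λ r i) : newL (newL Λ r i) r i = Λ := by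
  subst hm
  obtain ⟨⟨h1, h2, h3⟩, h4, h5⟩ := hF
  have s := chain_S3 h h1
  funext t
  by_cases ht : t = r + 1
  · subst ht
    rw [newL_eq, newL_eq, newL_ne (by omega), newL_ne (by omega)]
    exact refl3_refl3 s h3
  · rw [newL_ne ht, newL_ne ht]

lemma newL_chain {l : ℕ} {A : Fin l → ℕ} {σ : Equiv.Perm (Fin l)} {lam : ℕ → ℕ}
    {Λ : ℕ → ℕ → ℕ} {r i : ℕ} (h : IsChain' l l (cont l A σ) lam Λ) (hF : FF l Λ r i)
    (hr : r < l) (hr1 : r + 1 < l) :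
    IsChain' l l (cont l A (σ * Equiv.swap ⟨r, hr⟩ ⟨r + 1, hr1⟩)) lam (newL Λ r i) := by
  obtain ⟨⟨h1, h2, h3⟩, h4, h5⟩ := hF
  have s := chain_S3 h h1
  have s' := refl3_S3 s h3 (fun j hj => h4 j hj r h1)
  have st1 := h.2.1 r hr
  have st2 := h.2.1 (r + 1) hr1
  have hsum := refl3_sum h2 s h3 (st2.1.2.1 l le_rfl)
  have hsupp := refl3_supp h2 s st2.1.2.1
  have z1 := st1.1.2.2
  have z2 := st2.1.2.2
  have c1 : cont l A (σ * Equiv.swap ⟨r, hr⟩ ⟨r + 1, hr1⟩) r = cont l A σ (r + 1) - 1 := by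
    simp [cont, hr, hr1]
    ring
  have c2 : cont l A (σ * Equiv.swap ⟨r, hr⟩ ⟨r + 1, hr1⟩) (r + 1) = cont l A σ r + 1 := by
    simp [cont, hr, hr1]
    ring
  refine ⟨?_, fun t ht => ?_, fun t ht => ?_⟩
  · rw [newL_ne (by omega)]; exact h.1
  · by_cases e1 : t = r
    · subst e1
      rw [newL_eq, newL_ne (by omega), c1]
      refine ⟨⟨s'.h1, hsupp, ?_⟩, s'.h2⟩
      change ((ps _ l : ℕ) : ℤ) = (ps _ l : ℕ) + _
      change ((ps _ l : ℕ) : ℤ) = (ps _ l : ℕ) + _ at z1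
      change ((ps (Λ (_ + 2)) l : ℕ) : ℤ) = (ps _ l : ℕ) + _ at z2
      omega
    by_cases e2 : t = r + 1
    · subst e2
      rw [newL_eq, newL_ne (by omega), c2]
      refine ⟨⟨s'.h3, st2.1.2.1, ?_⟩, s'.h4⟩
      change ((ps (Λ (r + 2)) l : ℕ) : ℤ) = (ps _ l : ℕ) + _
      change ((ps _ l : ℕ) : ℤ) = (ps _ l : ℕ) + _ at z1
      change ((ps (Λ (_ + 2)) l : ℕ) : ℤ) = (ps _ l : ℕ) + _ at z2
      omega
    rw [newL_ne (by omega), newL_ne (by omega)]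
    have : cont l A (σ * Equiv.swap ⟨r, hr⟩ ⟨r + 1, hr1⟩) t = cont l A σ t := by
      simp only [cont, ht, dif_pos, Equiv.Perm.mul_apply]
      rw [Equiv.swap_apply_of_ne_of_ne] <;> simpa [Fin.ext_iff]
    rw [this]
    exact h.2.1 t ht
  · rw [newL_ne (by omega), newL_ne (by omega)]
    exact h.2.2 t ht

/-- In a lattice chain the contents decrease. -/
lemma lat_cont {l m : ℕ} {α : ℕ → ℤ} {lam : ℕ → ℕ} {Λ : ℕ → ℕ → ℕ}
    (h : IsChain' l m α lam Λ) (hm : m = l) (hL : LatC l Λ) (r : ℕ) (hr : r + 2 ≤ l) :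
    α (r + 1) ≤ α r := by
  subst hm
  obtain ⟨k, rfl⟩ : ∃ k, m = k + 1 := ⟨m - 1, by omega⟩
  have h1 := hL r k hr (by omega)
  have st1 := h.2.1 r (by omega)
  have st2 := h.2.1 (r + 1) (by omega)
  have z1 := st1.1.2.2
  have z2 := st2.1.2.2
  have a := st1.1.1 k
  rw [F3] at h1
  change ((ps (Λ (r + 1)) (k + 1) : ℕ) : ℤ) = (ps (Λ r) (k + 1) : ℕ) + α r at z1
  change ((ps (Λ (r + 2)) (k + 1) : ℕ) : ℤ) = (ps (Λ (r + 1)) (k + 1) : ℕ) + α (r + 1) at z2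
  have b1 := ps_succ (Λ r) k
  have b2 := ps_succ (Λ (r + 1)) k
  omega

lemma lat_perm {l : ℕ} {A : Fin l → ℕ} (hA : Antitone A) {σ : Equiv.Perm (Fin l)} {lam : ℕ → ℕ}
    {Λ : ℕ → ℕ → ℕ} (h : IsChain' l l (cont l A σ) lam Λ) (hL : LatC l Λ) : σ = 1 := by
  have hmono : StrictMono σ := by
    cases l with
    | zero => intro a; exact a.elim0
    | succ k =>
      rw [Fin.strictMono_iff_lt_succ]
      intro i
      have hi := i.2
      have := lat_cont h rfl hL i (by omega)
      simp only [cont, show (i : ℕ) < k + 1 by omega, show (i : ℕ) + 1 < k + 1 by omega,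
        dif_pos] at this
      by_contra hc
      rw [not_lt] at hc
      have h2 := hA hc
      have h3 : ((σ i.succ : Fin (k+1)) : ℕ) ≤ (σ i.castSucc : Fin (k+1)) := hc
      change ((A (σ i.succ) : ℕ) : ℤ) + _ - ((σ i.succ : Fin (k+1)) : ℕ) ≤
        (A (σ i.castSucc) : ℕ) + _ - ((σ i.castSucc : Fin (k+1)) : ℕ) at this
      push_cast at this
      omega
  have := StrictMono.range_inj (f := σ) (g := (1 : Equiv.Perm (Fin l))) hmono (fun a b h => h)
  ext x
  rw [this.1 (by simp [σ.surjective.range_eq, Set.range_id])]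

theorem lr_rule (l : ℕ) (A : Fin l → ℕ) (hA : Antitone A) (lam : ℕ → ℕ) (hlam : IsP l lam) :
    ∃ S : Finset (ℕ → ℕ → ℕ), (∀ Λ, Λ ∈ S ↔ IsChain' l l (cont l A 1) lam Λ ∧ LatC l Λ) ∧
      schur l A * al l lam = ∑ Λ ∈ S, al l (Λ l) := by
  classical
  choose S hS hsum using fun σ => chain_sum l (cont l A σ) lam hlam l
  refine ⟨(S 1).filter (LatC l), fun Λ => by rw [Finset.mem_filter, hS], ?_⟩
  have e1 : schur l A * al l lam =
      ∑ p ∈ Finset.univ.sigma S, Equiv.Perm.sign p.1 • al l (p.2 l) := by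
    rw [schur, Matrix.det_apply, Finset.sum_mul, Finset.sum_sigma]
    refine Finset.sum_congr rfl fun σ _ => ?_
    show _ = ∑ s ∈ S σ, Equiv.Perm.sign σ • al l (s l)
    rw [smul_mul_assoc, ← Finset.smul_sum, ← hsum, Finset.prod_range]
    congr 2
    refine Finset.prod_congr rfl fun j _ => ?_
    simp [cont]
  rw [e1, ← Finset.sum_filter_add_sum_filter_not _ (fun p => LatC l p.2)]
  have e2 : ∑ p ∈ (Finset.univ.sigma S).filter (fun p => ¬ LatC l p.2),
      Equiv.Perm.sign p.1 • al l (p.2 l) = 0 := by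
    have key : ∀ Λ, ¬ LatC l Λ → ∃ q : ℕ × ℕ, FF l Λ q.1 q.2 := fun Λ h => by
      obtain ⟨r, i, h⟩ := FF_exists h
      exact ⟨(r, i), h⟩
    choose! q hq using key
    let g : (Σ _ : Equiv.Perm (Fin l), (ℕ → ℕ → ℕ)) → (Σ _ : Equiv.Perm (Fin l), (ℕ → ℕ → ℕ)) :=
      fun p => if h : (q p.2).1 + 1 < l then
        ⟨p.1 * Equiv.swap ⟨(q p.2).1, by omega⟩ ⟨(q p.2).1 + 1, h⟩,
          newL p.2 (q p.2).1 (q p.2).2⟩ else p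
    have hq1 : ∀ Λ, ¬ LatC l Λ → (q Λ).1 + 1 < l := fun Λ h => by
      have := (hq Λ h).1.1; omega
    have notlat : ∀ Λ r i, FF l Λ r i → ¬ LatC l Λ := fun Λ r i h hL =>
      hL r i h.1.1 h.1.2.1 h.1.2.2
    have hg : ∀ p ∈ (Finset.univ.sigma S).filter (fun p => ¬ LatC l p.2),
        g p ∈ (Finset.univ.sigma S).filter (fun p => ¬ LatC l p.2) := by
      rintro ⟨σ, Λ⟩ hp
      simp only [Finset.mem_filter, Finset.mem_sigma, Finset.mem_univ, true_and, hS] at hp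
      simp only [g, hq1 Λ hp.2, dif_pos]
      simp only [Finset.mem_filter, Finset.mem_sigma, Finset.mem_univ, true_and, hS]
      exact ⟨newL_chain hp.1 (hq Λ hp.2) _ _, notlat _ _ _ (newL_FF hp.1 rfl (hq Λ hp.2))⟩
    refine Finset.sum_involution (fun p _ => g p) ?_ ?_ hg ?_
    · rintro ⟨σ, Λ⟩ hp
      simp only [Finset.mem_filter, Finset.mem_sigma, Finset.mem_univ, true_and, hS] at hp
      have hb := hq1 Λ hp.2
      simp only [g, hb, dif_pos]
      rw [Equiv.Perm.sign_mul, Equiv.Perm.sign_swap (by simp), newL_ne (by omega)]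
      simp
    · rintro ⟨σ, Λ⟩ hp _ he
      simp only [Finset.mem_filter, Finset.mem_sigma, Finset.mem_univ, true_and, hS] at hp
      have hb := hq1 Λ hp.2
      simp only [g, hb, dif_pos] at he
      have := congrArg (fun p => Equiv.Perm.sign p.1) he
      simp only [Equiv.Perm.sign_mul] at this
      rw [Equiv.Perm.sign_swap (by simp)] at this
      rcases Int.units_eq_one_or (Equiv.Perm.sign σ) with h | h <;> rw [h] at this <;>
        exact absurd this (by decide)
    · rintro ⟨σ, Λ⟩ hp
      simp only [Finset.mem_filter, Finset.mem_sigma, Finset.mem_univ, true_and, hS] at hp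
      have hb := hq1 Λ hp.2
      have hFF := newL_FF hp.1 rfl (hq Λ hp.2)
      have hu := FF_unique (hq _ (notlat _ _ _ hFF)) hFF
      have hpq : q (newL Λ (q Λ).1 (q Λ).2) = q Λ := Prod.ext hu.1 hu.2
      have h1 : g ⟨σ, Λ⟩ = ⟨σ * Equiv.swap ⟨(q Λ).1, by omega⟩ ⟨(q Λ).1 + 1, hb⟩,
          newL Λ (q Λ).1 (q Λ).2⟩ := by simp only [g, hb, dif_pos]
      rw [h1]
      simp only [g, hpq, hb, dif_pos, newL_newL hp.1 rfl (hq Λ hp.2), mul_assoc,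
        Equiv.swap_mul_self, mul_one]
  rw [e2, add_zero]
  symm
  refine Finset.sum_bij (fun Λ _ => ⟨1, Λ⟩) ?_ ?_ ?_ ?_
  · intro Λ hΛ
    simpa using hΛ
  · intro Λ _ Λ' _ h
    simpa using h
  · rintro ⟨σ, Λ⟩ hp
    simp only [Finset.mem_filter, Finset.mem_sigma, Finset.mem_univ, true_and] at hp
    have := lat_perm hA ((hS σ Λ).1 hp.1) hp.2
    subst this
    exact ⟨Λ, by simpa using hp, rfl⟩
  · intro Λ _
    simp

/-! ### Part 3: coefficients and positivity -/

lemma coeff_al (l : ℕ) (μ ν : ℕ → ℕ) (hμ : IsP l μ) (hν : IsP l ν) :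
    MvPolynomial.coeff (Finsupp.equivFunOnFinite.symm fun i : Fin l => μ i + (l - 1 - (i : ℕ)))
      (al l ν) = if (∀ i : Fin l, μ i = ν i) then 1 else 0 := by
  classical
  have hanti : ∀ lam : ℕ → ℕ, IsP l lam →
      StrictAnti (fun i : Fin l => lam i + (l - 1 - (i : ℕ))) := by
    intro lam h a b hab
    have h1 := h.1 (show (a : ℕ) ≤ b from hab.le)
    have h2 : (a : ℕ) < b := hab
    have := b.2
    simp only
    omega
  have hmon : ∀ σ : Equiv.Perm (Fin l), (∏ i : Fin l, (X (σ i) : MvPolynomial (Fin l) ℤ) ^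
      (ν i + (l - 1 - (i : ℕ)))) = monomial (Finsupp.equivFunOnFinite.symm fun i : Fin l =>
        ν (σ⁻¹ i) + (l - 1 - ((σ⁻¹ i : Fin l) : ℕ))) 1 := by
    intro σ
    rw [monomial_eq, map_one, one_mul, Finsupp.prod_fintype _ _ (by simp)]
    conv_rhs => rw [← Equiv.prod_comp σ]
    refine Finset.prod_congr rfl fun i _ => ?_
    simp
  rw [al, alt, Matrix.det_apply, coeff_sum]
  simp only [Matrix.of_apply, hmon]
  rw [Finset.sum_eq_single 1]
  · simp only [Equiv.Perm.sign_one, one_smul, coeff_monomial, inv_one, Equiv.Perm.coe_one, id]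
    congr 1
    rw [eq_iff_iff, Equiv.apply_eq_iff_eq, _root_.funext_iff]
    constructor
    · intro h i; have := h i; omega
    · intro h i; rw [h i]
  · intro σ _ hσ
    rw [coeff_smul, coeff_monomial, if_neg, smul_zero]
    intro h
    rw [Equiv.apply_eq_iff_eq] at h
    apply hσ
    have hm : StrictMono σ := by
      intro a b hab
      have h1 := hanti ν hν hab
      have ha := congrFun h (σ a)
      have hb := congrFun h (σ b)
      simp only [Equiv.Perm.inv_def, Equiv.symm_apply_apply] at ha hb
      simp only [ha, hb] at h1
      exact (hanti μ hμ).lt_iff_gt.1 h1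
    have := StrictMono.range_inj (f := σ) (g := (1 : Equiv.Perm (Fin l))) hm (fun a b h => h)
    ext x
    rw [this.1 (by simp [σ.surjective.range_eq, Set.range_id])]
  · simp

/-- `Q` is a nonnegative combination of the alternants of partitions, involving `μ`. -/
def Cone (l : ℕ) (μ : ℕ → ℕ) (Q : MvPolynomial (Fin l) ℤ) : Prop :=
  ∃ s : Multiset (ℕ → ℕ), (∀ ν ∈ s, IsP l ν) ∧ μ ∈ s ∧ Q = (s.map (al l)).sum

lemma cone_coeff {l : ℕ} {μ : ℕ → ℕ} {Q : MvPolynomial (Fin l) ℤ} (h : Cone l μ Q) :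
    0 < MvPolynomial.coeff
      (Finsupp.equivFunOnFinite.symm fun i : Fin l => μ i + (l - 1 - (i : ℕ))) Q := by
  obtain ⟨s, h1, h2, rfl⟩ := h
  have hμ := h1 μ h2
  obtain ⟨t, rfl⟩ := Multiset.exists_cons_of_mem h2
  rw [Multiset.map_cons, Multiset.sum_cons, coeff_add, coeff_al l μ μ hμ hμ, if_pos (fun _ => rfl)]
  have : ∀ t : Multiset (ℕ → ℕ), (∀ ν ∈ t, IsP l ν) → 0 ≤ MvPolynomial.coeff
      (Finsupp.equivFunOnFinite.symm fun i : Fin l => μ i + (l - 1 - (i : ℕ)))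
      ((t.map (al l)).sum) := by
    intro t
    induction t using Multiset.induction_on with
    | empty => simp
    | cons ν t ih =>
      intro ht
      rw [Multiset.map_cons, Multiset.sum_cons, coeff_add,
        coeff_al l μ ν hμ (ht ν (Multiset.mem_cons_self _ _))]
      have := ih fun ν' h' => ht ν' (Multiset.mem_cons_of_mem h')
      split_ifs <;> omega
  have := this t fun ν hν => h1 ν (Multiset.mem_cons_of_mem hν)
  omega

/-- A Littlewood–Richardson witness that `s_μ` occurs in `s_A * s_lam`; all conditions are linear. -/
def Good (l : ℕ) (lam A μ : ℕ → ℕ) : Prop :=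
  ∃ Λ : ℕ → ℕ → ℕ, Λ 0 = lam ∧ Λ l = μ ∧ (∀ r i, Λ r i ≤ Λ (r + 1) i) ∧
    (∀ r i, Λ (r + 1) (i + 1) ≤ Λ r i) ∧ (∀ r i, l ≤ i → Λ r i = 0) ∧
    (∀ r, r < l → ps (Λ (r + 1)) l = ps (Λ r) l + A r) ∧
    (∀ r i, ps (Λ (r + 2)) (i + 1) + ps (Λ r) i ≤ ps (Λ (r + 1)) (i + 1) + ps (Λ (r + 1)) i)

lemma ps_add (μ ν : ℕ → ℕ) (i : ℕ) : ps (μ + ν) i = ps μ i + ps ν i := Finset.sum_add_distrib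

lemma good_add {l : ℕ} {lam A μ lam' A' μ' : ℕ → ℕ} (h : Good l lam A μ) (h' : Good l lam' A' μ') :
    Good l (lam + lam') (A + A') (μ + μ') := by
  obtain ⟨Λ, a1, a2, a3, a4, a5, a6, a7⟩ := h
  obtain ⟨Λ', b1, b2, b3, b4, b5, b6, b7⟩ := h'
  refine ⟨fun r => Λ r + Λ' r, by simp [a1, b1], by simp [a2, b2], fun r i => ?_, fun r i => ?_,
    fun r i hi => ?_, fun r hr => ?_, fun r i => ?_⟩
  · exact Nat.add_le_add (a3 r i) (b3 r i)
  · exact Nat.add_le_add (a4 r i) (b4 r i)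
  · simp [a5 r i hi, b5 r i hi]
  · simp only [ps_add, Pi.add_apply, a6 r hr, b6 r hr]; ring
  · simp only [ps_add]
    have := a7 r i
    have := b7 r i
    omega

lemma ps_zero' (i : ℕ) : ps 0 i = 0 := by simp [ps]

lemma good_triv {l : ℕ} {lam : ℕ → ℕ} (h : IsP l lam) : Good l lam 0 lam := by
  refine ⟨fun _ => lam, rfl, rfl, fun _ _ => le_rfl, fun r i => h.1 (Nat.le_succ i),
    fun _ => h.2, fun _ _ => by simp, fun _ i => le_rfl⟩

lemma cone_step {l : ℕ} (A : Fin l → ℕ) (A' : ℕ → ℕ) (hAA : ∀ i : Fin l, A' i = A i)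
    (hA : Antitone A) {lam μ : ℕ → ℕ}
    (hg : Good l lam A' μ) {Q : MvPolynomial (Fin l) ℤ} (h : Cone l lam Q) :
    Cone l μ (schur l A * Q) := by
  classical
  obtain ⟨s, h1, h2, rfl⟩ := h
  have hlam := h1 lam h2
  have hany : ∀ t : Multiset (ℕ → ℕ), (∀ ν ∈ t, IsP l ν) →
      ∃ t' : Multiset (ℕ → ℕ), (∀ ν ∈ t', IsP l ν) ∧
        schur l A * (t.map (al l)).sum = (t'.map (al l)).sum := by
    intro t
    induction t using Multiset.induction_on with
    | empty => intro _; exact ⟨0, by simp, by simp⟩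
    | cons ν t ih =>
      intro ht
      obtain ⟨t', ht', e⟩ := ih fun ν' h' => ht ν' (Multiset.mem_cons_of_mem h')
      have hν := ht ν (Multiset.mem_cons_self _ _)
      obtain ⟨S, hS, hsum⟩ := lr_rule l A hA ν hν
      refine ⟨S.val.map (fun Λ => Λ l) + t', ?_, ?_⟩
      · intro ν' h'
        rw [Multiset.mem_add, Multiset.mem_map] at h'
        rcases h' with ⟨Λ, hΛ, rfl⟩ | h'
        · exact chain_isP hν ((hS Λ).1 hΛ).1 l
        · exact ht' _ h'
      · rw [Multiset.map_cons, Multiset.sum_cons, mul_add, e, hsum, Multiset.map_add,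
          Multiset.sum_add, Multiset.map_map]
        rfl
  obtain ⟨t, rfl⟩ := Multiset.exists_cons_of_mem h2
  obtain ⟨t', ht', e⟩ := hany t fun ν h => h1 ν (Multiset.mem_cons_of_mem h)
  obtain ⟨S, hS, hsum⟩ := lr_rule l A hA lam hlam
  refine ⟨S.val.map (fun Λ => Λ l) + t', ?_, ?_, ?_⟩
  · intro ν' h'
    rw [Multiset.mem_add, Multiset.mem_map] at h'
    rcases h' with ⟨Λ, hΛ, rfl⟩ | h'
    · exact chain_isP hlam ((hS Λ).1 hΛ).1 l
    · exact ht' _ h'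
  · rw [Multiset.mem_add, Multiset.mem_map]
    left
    obtain ⟨Λ, a1, a2, a3, a4, a5, a6, a7⟩ := hg
    refine ⟨fun r => Λ (min r l), (hS _).2 ⟨⟨by simpa using a1, fun r hr => ?_, fun r hr => ?_⟩,
      fun r i hr hi => ?_⟩, by simpa using a2⟩
    · beta_reduce
      rw [min_eq_left hr.le, min_eq_left (Nat.succ_le_of_lt hr)]
      refine ⟨⟨a3 r, a5 (r + 1), ?_⟩, a4 r⟩
      have := a6 r hr
      have h2 := hAA ⟨r, hr⟩
      simp only at h2
      rw [h2] at this
      simp only [cont, hr, dif_pos, Equiv.Perm.coe_one, id]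
      change ((ps _ l : ℕ) : ℤ) = (ps _ l : ℕ) + _
      rw [this]
      push_cast
      ring
    · simp [hr]
    · beta_reduce
      rw [min_eq_left (by omega), min_eq_left (by omega), min_eq_left (by omega), F3, not_lt]
      exact a7 r i
  · rw [Multiset.map_cons, Multiset.sum_cons, mul_add, e, hsum, Multiset.map_add,
      Multiset.sum_add, Multiset.map_map]
    rfl

/-- Reachability in `N` multiplications by `s_A`. -/
def Reach (l : ℕ) (A : ℕ → ℕ) : ℕ → (ℕ → ℕ) → (ℕ → ℕ) → Prop
  | 0, lam, μ => lam = μ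
  | N + 1, lam, μ => ∃ ν, Good l lam A ν ∧ Reach l A N ν μ

lemma reach_add {l : ℕ} {A A' : ℕ → ℕ} {N : ℕ} : ∀ {lam μ lam' μ' : ℕ → ℕ},
    Reach l A N lam μ → Reach l A' N lam' μ' → Reach l (A + A') N (lam + lam') (μ + μ') := by
  induction N with
  | zero => intro lam μ lam' μ' h h'; simp only [Reach] at *; rw [h, h']
  | succ N ih =>
    rintro lam μ lam' μ' ⟨ν, h1, h2⟩ ⟨ν', h1', h2'⟩
    exact ⟨ν + ν', good_add h1 h1', ih h2 h2'⟩

lemma reach_triv {l : ℕ} {lam : ℕ → ℕ} (h : IsP l lam) (N : ℕ) : Reach l 0 N lam lam := by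
  induction N with
  | zero => rfl
  | succ N ih => exact ⟨lam, good_triv h, ih⟩

lemma reach_trans {l : ℕ} {A : ℕ → ℕ} {M N : ℕ} : ∀ {lam μ ν : ℕ → ℕ},
    Reach l A M lam μ → Reach l A N μ ν → Reach l A (M + N) lam ν := by
  induction M with
  | zero => intro lam μ ν h h'; simp only [Reach] at h; rw [h, zero_add]; exact h'
  | succ M ih =>
    rintro lam μ ν ⟨κ, h1, h2⟩ h'
    rw [show M + 1 + N = (M + N) + 1 by ring]
    exact ⟨κ, h1, ih h2 h'⟩

lemma reach_cone {l : ℕ} (A : Fin l → ℕ) (A' : ℕ → ℕ) (hAA : ∀ i : Fin l, A' i = A i)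
    (hA : Antitone A) {N : ℕ} : ∀ {lam μ : ℕ → ℕ} {Q : MvPolynomial (Fin l) ℤ},
    Reach l A' N lam μ → Cone l lam Q → Cone l μ (schur l A ^ N * Q) := by
  induction N with
  | zero => intro lam μ Q h h'; simp only [Reach] at h; rw [pow_zero, one_mul, ← h]; exact h'
  | succ N ih =>
    rintro lam μ Q ⟨ν, h1, h2⟩ h'
    rw [pow_succ, mul_assoc]
    exact ih h2 (cone_step A A' hAA hA h1 h')

/-! ### Part 4: columns -/

/-- the column partition with `c` boxes -/
def om (c : ℕ) : ℕ → ℕ := fun i => if i < c then 1 else 0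

lemma om_isP {l c : ℕ} (h : c ≤ l) : IsP l (om c) := by
  refine ⟨fun a b hab => ?_, fun i hi => ?_⟩
  · simp only [om]; split_ifs <;> omega
  · simp only [om]; rw [if_neg (by omega)]

lemma ps_om (c i : ℕ) : ps (om c) i = min i c := by
  induction i with
  | zero => simp [ps_zero]
  | succ i ih => rw [ps_succ, ih, om]; split_ifs <;> omega

lemma good_col {l c : ℕ} {lam μ : ℕ → ℕ} (h1 : IsP l lam) (h2 : IsP l μ) (h3 : ∀ i, lam i ≤ μ i)
    (h4 : ∀ i, μ i ≤ lam i + 1) (h5 : ps μ l = ps lam l + c) : Good l lam (om c) μ := by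
  obtain ⟨e, rfl⟩ : ∃ e, μ = lam + e := ⟨fun i => μ i - lam i, by
    funext i; have := h3 i; simp only [Pi.add_apply]; omega⟩
  have he : ∀ i, e i ≤ 1 := fun i => by have := h4 i; simp only [Pi.add_apply] at this; omega
  have hel : ∀ i, l ≤ i → e i = 0 := fun i hi => by
    have := h2.2 i hi; simp only [Pi.add_apply] at this; omega
  rw [ps_add] at h5
  obtain rfl : ps e l = c := by omega
  have hsle : ∀ i, ps e i ≤ i := by
    intro i
    induction i with
    | zero => simp [ps_zero]
    | succ i ih => rw [ps_succ]; have := he i; omega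
  let Λ : ℕ → ℕ → ℕ := fun r i => lam i + min r (ps e (i + 1)) - min r (ps e i)
  have hps : ∀ r i, ps (Λ r) i = ps lam i + min r (ps e i) := by
    intro r i
    induction i with
    | zero => simp [ps_zero]
    | succ i ih =>
      rw [ps_succ, ih, ps_succ lam]
      simp only [Λ]
      rw [ps_succ e]
      omega
  refine ⟨Λ, ?_, ?_, fun r i => ?_, fun r i => ?_, fun r i hi => ?_, fun r hr => ?_,
    fun r i => ?_⟩
  · funext i; simp [Λ]
  · funext i
    simp only [Λ, Pi.add_apply]
    have a := hsle (i + 1)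
    rw [ps_succ] at a ⊢
    have := he i
    rcases lt_or_ge i l with hi | hi
    · omega
    · rw [hel i hi]; omega
  · simp only [Λ]
    have := he i
    rw [ps_succ]
    omega
  · simp only [Λ]
    have := he i
    have := he (i + 1)
    have := h1.1 (Nat.le_succ i)
    have := h2.1 (Nat.le_succ i)
    simp only [Pi.add_apply] at this
    rw [ps_succ e (i + 1), ps_succ e i]
    simp only [Nat.succ_eq_add_one] at *
    omega
  · simp only [Λ]
    rw [ps_succ, hel i hi, h1.2 i hi]
    omega
  · rw [hps, hps, om]
    split_ifs <;> omega
  · rw [hps, hps, hps, hps, ps_succ e]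
    have := he i
    omega

lemma ps_le {μ ν : ℕ → ℕ} (h : ∀ i, μ i ≤ ν i) (i : ℕ) : ps μ i ≤ ps ν i :=
  Finset.sum_le_sum fun j _ => h j

lemma ps_mul (k : ℕ) (μ : ℕ → ℕ) (i : ℕ) : ps (fun j => k * μ j) i = k * ps μ i :=
  (Finset.mul_sum _ _ _).symm

lemma eq_of_ps_le {l : ℕ} {μ ν : ℕ → ℕ} (h1 : IsP l μ) (h2 : IsP l ν) (h : ∀ i, μ i ≤ ν i)
    (hs : ps μ l = ps ν l) : μ = ν := by
  have := (Finset.sum_eq_sum_iff_of_le (s := range l) (f := μ) (g := ν) fun i _ => h i).1 hs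
  funext i
  rcases lt_or_ge i l with hi | hi
  · exact this i (Finset.mem_range.2 hi)
  · rw [h1.2 i hi, h2.2 i hi]

lemma reach_col {l c N : ℕ} : ∀ {lam μ : ℕ → ℕ}, IsP l lam → IsP l μ → (∀ i, lam i ≤ μ i) →
    (∀ i, μ i ≤ lam i + N) → ps μ l = ps lam l + N * c → Reach l (om c) N lam μ := by
  induction N with
  | zero =>
    intro lam μ h1 h2 h3 h4 h5
    exact eq_of_ps_le h1 h2 h3 (by omega)
  | succ N ih =>
    intro lam μ h1 h2 h3 h4 h5
    let up : ℕ → ℕ := fun i => min (lam i + 1) (μ i)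
    let lo : ℕ → ℕ := fun i => max (lam i) (μ i - N)
    let nu : ℕ → ℕ → ℕ := fun t i => if i < t then up i else lo i
    have hlu : ∀ i, lo i ≤ up i := fun i => by
      have := h3 i; have := h4 i; simp only [lo, up]; omega
    have hlo : ps lo l ≤ ps lam l + c := by
      have : ps ((fun j => (N + 1) * lo j) + lam) l ≤ ps (μ + fun j => (N + 1) * lam j) l := by
        apply ps_le
        intro i
        have a := h3 i
        have b := h4 i
        simp only [Pi.add_apply]
        rcases (show lo i = lam i ∨ (lo i = lam i + 1 ∧ μ i = lam i + (N + 1)) by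
          simp only [lo]; omega) with e | ⟨e, e'⟩
        · rw [e]; omega
        · rw [e, e']; linarith
      rw [ps_add, ps_add, ps_mul, ps_mul, h5] at this
      nlinarith
    have hup : ps lam l + c ≤ ps up l := by
      have : ps (μ + fun j => (N + 1) * lam j) l ≤ ps ((fun j => (N + 1) * up j) + lam) l := by
        apply ps_le
        intro i
        have a := h3 i
        have b := h4 i
        simp only [Pi.add_apply]
        rcases (show (up i = lam i ∧ μ i = lam i) ∨ up i = lam i + 1 by
          simp only [up]; omega) with ⟨e, e'⟩ | e
        · rw [e, e']; omega
        · rw [e]; linarith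
      rw [ps_add, ps_add, ps_mul, ps_mul, h5] at this
      nlinarith
    have g0 : ps (nu 0) l = ps lo l := ps_congr fun j _ => by simp [nu]
    have gl : ps (nu l) l = ps up l := ps_congr fun j hj => by simp [nu, hj]
    have gs : ∀ t, ps (nu (t + 1)) l ≤ ps (nu t) l + 1 := by
      intro t
      have : ps (nu (t + 1)) l ≤ ps (nu t + fun i => if i = t then 1 else 0) l := by
        apply ps_le
        intro i
        have := h3 i
        have := h4 i
        simp only [nu, Pi.add_apply, up, lo]
        split_ifs <;> omega
      rw [ps_add] at this
      have h' : ps (fun i => if i = t then 1 else 0) l ≤ 1 := by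
        simp only [ps, Finset.sum_ite_eq']
        split_ifs <;> omega
      omega
    have hex : ∃ t, ps (nu t) l = ps lam l + c := by
      classical
      have hx : ∃ t, ps lam l + c ≤ ps (nu t) l := ⟨l, by omega⟩
      have s1 := Nat.find_spec hx
      have s2 := fun t => Nat.find_min (m := t) hx
      refine ⟨Nat.find hx, ?_⟩
      generalize Nat.find hx = t at *
      cases t with
      | zero => omega
      | succ t => have := s2 t (by omega); have := gs t; omega
    obtain ⟨t, ht⟩ := hex
    have hnu : IsP l (nu t) := by
      refine ⟨antitone_nat_of_succ_le fun i => ?_, fun i hi => ?_⟩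
      · have := h3 i; have := h3 (i + 1); have := h4 i; have := h4 (i + 1)
        have := h1.1 (Nat.le_succ i)
        have := h2.1 (Nat.le_succ i)
        simp only [Nat.succ_eq_add_one] at *
        simp only [nu, up, lo]
        split_ifs <;> omega
      · have := h1.2 i hi
        have := h2.2 i hi
        simp only [nu, up, lo]
        split_ifs <;> omega
    refine ⟨nu t, good_col h1 hnu (fun i => ?_) (fun i => ?_) ht, ih hnu h2 (fun i => ?_)
      (fun i => ?_) ?_⟩
    all_goals try (have := h3 i; have := h4 i; simp only [nu, up, lo]; split_ifs <;> omega)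
    rw [h5, ht]; ring

/-! ### Part 5: the combinatorial core -/

lemma isP_add {l : ℕ} {μ ν : ℕ → ℕ} (h : IsP l μ) (h' : IsP l ν) : IsP l (μ + ν) :=
  ⟨fun _ _ hab => Nat.add_le_add (h.1 hab) (h'.1 hab), fun i hi => by
    simp [h.2 i hi, h'.2 i hi]⟩

lemma isP_zero (l : ℕ) : IsP l 0 := ⟨fun _ _ _ => le_rfl, fun _ _ => rfl⟩

/-- `G_J` extended by zero. -/
def Gx (l ι : ℕ) (f : Fin l → Fin ι) (A : ℕ → ℕ) : ℕ → ℕ := pad l (GJ l ι f fun j => A j)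

lemma Gx_of_lt {l ι : ℕ} (f : Fin l → Fin ι) (A : ℕ → ℕ) {i : ℕ} (h : i < l) :
    Gx l ι f A i = (Lnum l / bsize l ι f (f ⟨i, h⟩)) * bsum l ι f (fun j => A j) (f ⟨i, h⟩) := by
  simp [Gx, pad, h, GJ]

lemma Gx_of_ge {l ι : ℕ} (f : Fin l → Fin ι) (A : ℕ → ℕ) {i : ℕ} (h : l ≤ i) :
    Gx l ι f A i = 0 := by
  simp [Gx, pad, Nat.not_lt.2 h]

lemma Gx_add {l ι : ℕ} (f : Fin l → Fin ι) (A A' : ℕ → ℕ) :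
    Gx l ι f (A + A') = Gx l ι f A + Gx l ι f A' := by
  funext i
  rcases lt_or_ge i l with h | h
  · simp only [Pi.add_apply, Gx_of_lt f _ h, bsum, Finset.sum_add_distrib, mul_add]
  · simp only [Pi.add_apply, Gx_of_ge f _ h]

lemma Gx_zero {l ι : ℕ} (f : Fin l → Fin ι) : Gx l ι f 0 = 0 := by
  funext i
  rcases lt_or_ge i l with h | h
  · simp [Gx_of_lt f _ h, bsum]
  · simp [Gx_of_ge f _ h]

lemma Lnum_pos (l : ℕ) : 0 < Lnum l := by
  rw [Nat.pos_iff_ne_zero, Lnum, Ne, Finset.lcm_eq_zero_iff]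
  simp

lemma bsize_pos {l ι : ℕ} (f : Fin l → Fin ι) (i : Fin l) : 0 < bsize l ι f (f i) :=
  Finset.card_pos.2 ⟨i, by simp⟩

lemma bsize_dvd {l ι : ℕ} (f : Fin l → Fin ι) (i : Fin l) : bsize l ι f (f i) ∣ Lnum l := by
  have h : bsize l ι f (f i) ≤ l := by
    have := Finset.card_le_univ (Finset.univ.filter fun j => f j = f i)
    simpa [bsize] using this
  exact Finset.dvd_lcm (f := id) (Finset.mem_Icc.2 ⟨bsize_pos f i, h⟩)

lemma bsum_om {l ι : ℕ} (f : Fin l → Fin ι) (c : ℕ) (j : Fin ι) :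
    bsum l ι f (fun i => om c i) j =
      ((Finset.univ.filter fun i => f i = j).filter fun i : Fin l => (i : ℕ) < c).card := by
  simp only [bsum, om]
  rw [Finset.card_filter]

lemma Gx_om_le {l ι : ℕ} (f : Fin l → Fin ι) (c i : ℕ) : Gx l ι f (om c) i ≤ Lnum l := by
  rcases lt_or_ge i l with h | h
  · rw [Gx_of_lt f _ h, bsum_om]
    calc _ ≤ Lnum l / bsize l ι f (f ⟨i, h⟩) * bsize l ι f (f ⟨i, h⟩) :=
          Nat.mul_le_mul_left _ (Finset.card_filter_le _ _)
      _ = _ := Nat.div_mul_cancel (bsize_dvd f _)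
  · simp [Gx_of_ge f _ h]

lemma Gx_om_pos {l ι : ℕ} (f : Fin l → Fin ι) {c p : ℕ} (hp : p < c) (hl : p < l) :
    0 < Gx l ι f (om c) p := by
  rw [Gx_of_lt f _ hl, bsum_om]
  refine Nat.mul_pos (Nat.div_pos (Nat.le_of_dvd (Lnum_pos l) (bsize_dvd f _)) (bsize_pos f _)) ?_
  exact Finset.card_pos.2 ⟨⟨p, hl⟩, by simpa using hp⟩

lemma Gx_om_lt {l ι : ℕ} (f : Fin l → Fin ι) {c q : ℕ} (hq : c ≤ q) (hl : q < l) :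
    Gx l ι f (om c) q < Lnum l := by
  rw [Gx_of_lt f _ hl, bsum_om]
  calc _ < Lnum l / bsize l ι f (f ⟨q, hl⟩) * bsize l ι f (f ⟨q, hl⟩) := by
        refine Nat.mul_lt_mul_of_pos_left ?_
          (Nat.div_pos (Nat.le_of_dvd (Lnum_pos l) (bsize_dvd f _)) (bsize_pos f _))
        refine Finset.card_lt_card ⟨Finset.filter_subset _ _, fun h => ?_⟩
        have := h (show (⟨q, hl⟩ : Fin l) ∈ _ by simp)
        simp at this
        omega
    _ = _ := Nat.div_mul_cancel (bsize_dvd f _)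

lemma Gx_om_isP {l ι : ℕ} (f : Fin l → Fin ι) (hf : Monotone f) (c : ℕ) :
    IsP l (Gx l ι f (om c)) := by
  refine ⟨fun i i' hii => ?_, fun i hi => Gx_of_ge f _ hi⟩
  rcases lt_or_ge i' l with h' | h'
  swap
  · rw [Gx_of_ge f _ h']; exact Nat.zero_le _
  have h : i < l := by omega
  have hle : f ⟨i, h⟩ ≤ f ⟨i', h'⟩ := hf hii
  rcases hle.eq_or_lt with e | e
  · rw [Gx_of_lt f _ h, Gx_of_lt f _ h', e]
  by_cases hx : ∃ j : Fin l, f j = f ⟨i', h'⟩ ∧ (j : ℕ) < c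
  · obtain ⟨j, hj, hjc⟩ := hx
    refine (Gx_om_le f c i').trans ?_
    rw [Gx_of_lt f _ h, bsum_om, Finset.filter_true_of_mem]
    · exact (Nat.div_mul_cancel (bsize_dvd f _)).ge
    · intro a ha
      simp only [Finset.mem_filter, Finset.mem_univ, true_and] at ha
      have : a < j := by
        by_contra hc
        have := hf (not_lt.1 hc)
        rw [ha, hj] at this
        exact absurd e (not_lt.2 this)
      have : (a : ℕ) < j := this
      omega
  · have : bsum l ι f (fun i => om c i) (f ⟨i', h'⟩) = 0 := by
      rw [bsum_om, Finset.card_eq_zero, Finset.filter_eq_empty_iff]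
      intro a ha hac
      exact hx ⟨a, by simpa using ha, hac⟩
    show Gx l ι f (om c) i' ≤ _
    rw [Gx_of_lt f _ h', this]
    simp

lemma Gx_sum {l ι : ℕ} (f : Fin l → Fin ι) (A : ℕ → ℕ) :
    ps (Gx l ι f A) l = Lnum l * ps A l := by
  have e1 : ps (Gx l ι f A) l = ∑ i : Fin l, GJ l ι f (fun j => A j) i := by
    rw [ps, Finset.sum_range]
    refine Finset.sum_congr rfl fun i _ => ?_
    simp [Gx, pad]
  have e2 : ps A l = ∑ i : Fin l, A i := by rw [ps, Finset.sum_range]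
  rw [e1, e2, ← Finset.sum_fiberwise (s := univ) f, ← Finset.sum_fiberwise (s := univ) f (fun i : Fin l => A i),
    Finset.mul_sum]
  refine Finset.sum_congr rfl fun j _ => ?_
  rw [Finset.sum_congr rfl (g := fun _ => (Lnum l / bsize l ι f j) * bsum l ι f (fun i => A i) j)]
  · rw [Finset.sum_const, smul_eq_mul, ← mul_assoc]
    change bsize l ι f j * _ * bsum l ι f (fun i => A i) j = _ * bsum l ι f (fun i => A i) j
    rcases Finset.eq_empty_or_nonempty (Finset.univ.filter fun i => f i = j) with h | ⟨i, hi⟩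
    · simp [bsum, h]
    · simp only [Finset.mem_filter, Finset.mem_univ, true_and] at hi
      rw [← hi, Nat.mul_div_cancel' (bsize_dvd f i)]
  · intro i hi
    simp only [Finset.mem_filter, Finset.mem_univ, true_and] at hi
    simp [GJ, hi]

lemma desc {l c : ℕ} {A : ℕ → ℕ} (hA : IsP l A) (hc : 0 < c) (h : A c < A (c - 1)) :
    c ≤ l ∧ ∃ A0, IsP l A0 ∧ A = A0 + om c := by
  have hcl : c ≤ l := by
    by_contra hx
    have := hA.2 (c - 1) (by omega)
    omega
  have hge : ∀ i, i < c → A c < A i := fun i hi => h.trans_le (hA.1 (show i ≤ c - 1 by omega))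
  refine ⟨hcl, fun i => A i - om c i, ⟨fun i j hij => ?_, fun i hi => ?_⟩, ?_⟩
  · have := hA.1 hij
    simp only [om]
    by_cases h1 : i < c
    · by_cases h2 : j < c
      · rw [if_pos h1, if_pos h2]; omega
      · have := hA.1 (not_lt.1 h2)
        have := hge i h1
        rw [if_pos h1, if_neg h2]; omega
    · rw [if_neg h1, if_neg (by omega)]; omega
  · simp [hA.2 i hi]
  · funext i
    simp only [om, Pi.add_apply]
    split_ifs with h1
    · have := hge i h1; omega
    · rfl

lemma col_ind {l : ℕ} {P : (ℕ → ℕ) → Prop} (h0 : P 0)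
    (h1 : ∀ A c, c ≤ l → IsP l A → P A → P (A + om c)) : ∀ A, IsP l A → P A := by
  have : ∀ n A, IsP l A → ps A l = n → P A := by
    intro n
    induction n using Nat.strong_induction_on with
    | _ n ih =>
      intro A hA hn
      by_cases hz : A = 0
      · rw [hz]; exact h0
      classical
      have hx : ∃ i, A i = 0 := ⟨l, hA.2 l le_rfl⟩
      have s1 := Nat.find_spec hx
      have s2 := fun t => Nat.find_min (m := t) hx
      generalize Nat.find hx = c at *
      have hc : 0 < c := by
        rcases Nat.eq_zero_or_pos c with rfl | h
        · exfalso
          apply hz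
          funext i
          have := hA.1 (Nat.zero_le i)
          simp only [Pi.zero_apply]
          omega
        · exact h
      obtain ⟨hcl, A0, hA0, rfl⟩ := desc hA hc (by have := s2 (c - 1) (by omega); omega)
      rw [ps_add, ps_om] at hn
      exact h1 A0 c hcl hA0 (ih (ps A0 l) (by omega) A0 hA0 rfl)
  exact fun A hA => this _ A hA rfl

lemma Gx_isP {l ι : ℕ} (f : Fin l → Fin ι) (hf : Monotone f) (A : ℕ → ℕ) (hA : IsP l A) :
    IsP l (Gx l ι f A) := by
  refine col_ind (P := fun A => IsP l (Gx l ι f A)) ?_ (fun A c _ _ h => ?_) A hA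
  · rw [Gx_zero]; exact isP_zero l
  · rw [Gx_add]; exact isP_add h (Gx_om_isP f hf c)

lemma reach_G {l ι : ℕ} (f : Fin l → Fin ι) (hf : Monotone f) (A : ℕ → ℕ) (hA : IsP l A) :
    Reach l A (Lnum l) 0 (Gx l ι f A) := by
  refine col_ind (P := fun A => Reach l A (Lnum l) 0 (Gx l ι f A)) ?_ (fun A c hc _ h => ?_) A hA
  · rw [Gx_zero]; exact reach_triv (isP_zero l) _
  · rw [Gx_add]
    have : Reach l (om c) (Lnum l) 0 (Gx l ι f (om c)) := by
      refine reach_col (isP_zero l) (Gx_om_isP f hf c) (fun i => Nat.zero_le _) (fun i => ?_) ?_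
      · simpa using Gx_om_le f c i
      · rw [Gx_sum, ps_om, ps_zero', min_eq_right hc, zero_add]
    have := reach_add h this
    rwa [add_zero] at this

lemma reach_one {l : ℕ} (A : ℕ → ℕ) (hA : IsP l A) : Reach l A 1 0 A := by
  refine col_ind (P := fun A => Reach l A 1 0 A) ?_ (fun A c hc _ h => ?_) A hA
  · exact reach_triv (isP_zero l) _
  · have : Reach l (om c) 1 0 (om c) := by
      refine reach_col (isP_zero l) (om_isP hc) (fun i => Nat.zero_le _) (fun i => ?_) ?_
      · simp only [om, Pi.zero_apply]; split_ifs <;> omega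
      · rw [ps_om, ps_zero', min_eq_right hc, zero_add, one_mul]
    have := reach_add h this
    rwa [add_zero] at this

lemma reach_key {l ι : ℕ} (f : Fin l → Fin ι) (hf : Monotone f) {p q c : ℕ} (hpc : p < c)
    (hcq : c ≤ q) (hq : q < l) :
    Reach l (om c) (Lnum l) (om (p + 1) + om q) (om p + om (q + 1) + Gx l ι f (om c)) := by
  refine reach_col (isP_add (om_isP (by omega)) (om_isP (by omega)))
    (isP_add (isP_add (om_isP (by omega)) (om_isP (by omega))) (Gx_om_isP f hf c))
    (fun i => ?_) (fun i => ?_) ?_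
  · have hp := Gx_om_pos f hpc (by omega : p < l)
    simp only [Pi.add_apply]
    by_cases hi : i = p
    · subst hi
      simp only [om] at hp ⊢
      split_ifs <;> omega
    · have : om (p + 1) i + om q i ≤ om p i + om (q + 1) i := by
        simp only [om]; split_ifs <;> omega
      omega
  · have hp := Gx_om_lt f hcq hq
    have hle := Gx_om_le f c i
    simp only [Pi.add_apply]
    by_cases hi : i = q
    · subst hi
      have : om p i + om (i + 1) i = 1 := by
        simp only [om]; split_ifs <;> omega
      omega
    · have : om p i + om (q + 1) i ≤ om (p + 1) i + om q i := by
        simp only [om]; split_ifs <;> omega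
      omega
  · rw [ps_add, ps_add, ps_add, Gx_sum]
    simp only [ps_om]
    rw [min_eq_right (by omega : c ≤ l)]
    have : min l p + min l (q + 1) = min l (p + 1) + min l q := by omega
    omega

lemma main_ind {l ι : ℕ} (f : Fin l → Fin ι) (hf : Monotone f) {A B : ℕ → ℕ} (hA : IsP l A)
    (hB : IsP l B) : ∀ (d : ℕ) (C : ℕ → ℕ), IsP l C → ps C l = ps B l → (∀ i, ps B i ≤ ps C i) →
    (∀ i, B i < C i → C i ≤ A i) → (∀ i, C i < B i → A i ≤ C i) →
    ∑ i ∈ range l, (C i - B i) = d →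
    Reach l A (d * Lnum l) C (B + fun i => d * Gx l ι f A i) := by
  intro d
  induction d with
  | zero =>
    intro C hC hps _ _ _ hd
    rw [zero_mul]
    have : C = B := eq_of_ps_le hC hB (fun i => by
      rcases lt_or_ge i l with hi | hi
      · have := (Finset.sum_eq_zero_iff.1 hd) i (Finset.mem_range.2 hi)
        omega
      · rw [hC.2 i hi, hB.2 i hi]) hps
    rw [this]
    show B = _
    funext i
    simp
  | succ d ih =>
    intro C hC hps hdom hup hdn hd
    classical
    have hxq : ∃ q, C q < B q := by
      by_contra hx
      push Not at hx
      have := eq_of_ps_le hB hC hx hps.symm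
      rw [this] at hd
      simp at hd
    obtain ⟨q, hq, hqm⟩ : ∃ q, C q < B q ∧ ∀ i, i < q → B i ≤ C i :=
      ⟨Nat.find hxq, Nat.find_spec hxq, fun i hi => not_lt.1 (Nat.find_min hxq hi)⟩
    have hql : q < l := by
      by_contra hx
      have := hB.2 q (by omega)
      omega
    have hxp : ∃ p, p < q ∧ B p < C p := by
      by_contra hx
      push Not at hx
      have e : ps C q = ps B q := ps_congr fun j hj => le_antisymm (hx j hj) (hqm j hj)
      have := hdom (q + 1)
      rw [ps_succ, ps_succ] at this
      omega
    obtain ⟨p, hpq, hp, hpm⟩ : ∃ p, p < q ∧ B p < C p ∧ ∀ i, p < i → i < q → C i = B i := by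
      obtain ⟨p0, hp0, hp0'⟩ := hxp
      have hs := Nat.findGreatest_spec (P := fun p => p < q ∧ B p < C p) hp0.le ⟨hp0, hp0'⟩
      refine ⟨_, hs.1, hs.2, fun i hi hiq => ?_⟩
      have := Nat.findGreatest_is_greatest hi hiq.le
      have := hqm i hiq
      by_contra hne
      apply ‹¬ (_ ∧ _)›
      exact ⟨hiq, by omega⟩
    have hApq : A q < A p := by
      have := hup p hp
      have := hdn q hq
      have := hB.1 hpq.le
      omega
    obtain ⟨c, hpc, hcq, hc⟩ : ∃ c, p < c ∧ c ≤ q ∧ A c < A (c - 1) := by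
      by_contra hx
      push Not at hx
      have : ∀ i, p ≤ i → i ≤ q → A p ≤ A i := by
        intro i hi
        induction i, hi using Nat.le_induction with
        | base => intro _; exact le_rfl
        | succ i hi ih' =>
          intro hiq
          have h1 := ih' (by omega)
          have h2 := hx (i + 1) (by omega) hiq
          simp only [Nat.add_sub_cancel] at h2
          omega
      have := this q hpq.le le_rfl
      omega
    obtain ⟨-, A0, hA0, hAe⟩ := desc hA (by omega) hc
    obtain ⟨-, C1, hC1, hCe⟩ := desc (c := q) hC (by omega) (by
      have := hqm (q - 1) (by omega)
      have := hB.1 (show q - 1 ≤ q by omega)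
      omega)
    obtain ⟨-, C0, hC0, hCe1⟩ := desc (c := p + 1) hC1 (by omega) (by
      have e1 := congrFun hCe p
      have e2 := congrFun hCe (p + 1)
      simp only [Pi.add_apply, om] at e1 e2
      rw [if_pos hpq] at e1
      simp only [Nat.add_sub_cancel]
      have := hB.1 (Nat.le_succ p)
      simp only [Nat.succ_eq_add_one] at this
      by_cases h : p + 1 < q
      · rw [if_pos h] at e2
        have := hpm (p + 1) (by omega) h
        omega
      · have : p + 1 = q := by omega
        rw [if_neg h] at e2
        subst this
        omega)
    set C' : ℕ → ℕ := C0 + (om p + om (q + 1)) with hC'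
    have hCC : C = C0 + (om (p + 1) + om q) := by rw [hCe, hCe1, add_assoc]
    have hC'P : IsP l C' := isP_add hC0 (isP_add (om_isP (by omega)) (om_isP (by omega)))
    have hval : ∀ i, C' i + (if i = p then 1 else 0) = C i + (if i = q then 1 else 0) := by
      intro i
      rw [hC', hCC]
      simp only [Pi.add_apply, om]
      split_ifs <;> omega
    have hpsv : ∀ i, ps C' i + (if p < i then 1 else 0) = ps C i + (if q < i then 1 else 0) := by
      intro i
      rw [hC', hCC]
      simp only [ps_add, ps_om]
      split_ifs <;> omega
    have hstrict : ∀ i, p + 1 ≤ i → i ≤ q → ps B i < ps C i := by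
      intro i hi
      induction i, hi using Nat.le_induction with
      | base =>
        intro _
        have := hdom p
        rw [ps_succ, ps_succ]; omega
      | succ i hi ih' =>
        intro hiq
        have h1 := ih' (by omega)
        have h2 := hqm i (by omega)
        rw [ps_succ, ps_succ]; omega
    have step : Reach l A (Lnum l) C (C' + Gx l ι f A) := by
      have := reach_add (reach_add (reach_triv hC0 (Lnum l)) (reach_G f hf A0 hA0))
        (reach_key f hf hpc hcq hql)
      rw [zero_add, add_zero, ← hAe, ← hCC] at this
      convert this using 1
      rw [hC']
      conv_lhs => rw [hAe, Gx_add]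
      abel
    have hrec1 := ih C' hC'P (by
        have := hpsv l
        rw [if_pos (by omega), if_pos hql] at this
        omega)
      (by
        intro i
        have := hpsv i
        have := hdom i
        have := hstrict i
        split_ifs at * <;> omega)
      (by
        intro i hi
        have := hval i
        have := hup i
        split_ifs at * with h1 h2 h2
        · omega
        · omega
        · subst h2; omega
        · omega)
      (by
        intro i hi
        have := hval i
        have := hdn i
        split_ifs at * with h1 h2 h2
        · omega
        · subst h1; omega
        · subst h2; omega
        · omega)
      (by
        have : ∑ i ∈ range l, (C' i - B i) + ∑ i ∈ range l, (if i = p then 1 else 0) =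
            ∑ i ∈ range l, (C i - B i) := by
          rw [← Finset.sum_add_distrib]
          refine Finset.sum_congr rfl fun i _ => ?_
          have := hval i
          split_ifs at * with h1 h2 h2
          · omega
          · subst h1; omega
          · subst h2; omega
          · omega
        rw [Finset.sum_ite_eq', if_pos (Finset.mem_range.2 (by omega))] at this
        omega)
    have hGP := Gx_isP f hf A hA
    have hrec2 := reach_add hrec1 (reach_triv hGP (d * Lnum l))
    rw [add_zero] at hrec2
    have fin := reach_trans step hrec2
    convert fin using 1
    · ring
    · funext i
      simp only [Pi.add_apply]
      ring

lemma ncard_YD (l : ℕ) (A B : Fin l → ℕ) : (YD l A \ YD l B).ncard = ∑ i, (A i - B i) := by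
  have : YD l A \ YD l B = (fun s : (_ : Fin l) × ℕ => (s.1, s.2)) ''
      ((Finset.univ.sigma fun i : Fin l => Finset.Ico (B i) (A i) : Finset _) :
        Set ((_ : Fin l) × ℕ)) := by
    ext ⟨i, j⟩
    simp only [YD, Set.mem_diff, Set.mem_setOf_eq, Set.mem_image, Finset.mem_coe,
      Finset.mem_sigma, Finset.mem_univ, true_and, Finset.mem_Ico, Prod.mk.injEq]
    constructor
    · rintro ⟨h1, h2⟩
      exact ⟨⟨i, j⟩, ⟨not_lt.1 h2, h1⟩, rfl, rfl⟩
    · rintro ⟨⟨a, b⟩, ⟨h1, h2⟩, rfl, rfl⟩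
      exact ⟨h2, not_lt.2 h1⟩
  rw [this, Set.ncard_image_of_injective, Set.ncard_coe_finset, Finset.card_sigma]
  · simp
  · rintro ⟨a, b⟩ ⟨c, d⟩ h
    simp only [Prod.mk.injEq] at h
    obtain ⟨rfl, rfl⟩ := h
    rfl

lemma pad_isP {l : ℕ} {A : Fin l → ℕ} (hA : Antitone A) : IsP l (pad l A) := by
  refine ⟨fun i j hij => ?_, fun i hi => by simp [pad, Nat.not_lt.2 hi]⟩
  rcases lt_or_ge j l with h | h
  · simp only [pad]
    rw [dif_pos h, dif_pos (by omega)]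
    exact hA hij
  · simp [pad, Nat.not_lt.2 h]

lemma pad_fin {l : ℕ} (A : Fin l → ℕ) (i : Fin l) : pad l A i = A i := by simp [pad]

lemma ps_pad_l {l : ℕ} (A : Fin l → ℕ) : ps (pad l A) l = ∑ i, A i := by
  rw [ps, Finset.sum_range]
  exact Finset.sum_congr rfl fun i _ => pad_fin A i

lemma ps_pad {l : ℕ} (A : Fin l → ℕ) (r : ℕ) :
    ps (pad l A) r = ∑ i ∈ Finset.univ.filter (fun i : Fin l => (i : ℕ) < r), A i := by
  rw [Finset.sum_filter, ps]
  have e : ∑ i : Fin l, (if (i : ℕ) < r then A i else 0) =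
      ∑ i ∈ range l, (if i < r then pad l A i else 0) := by
    rw [Finset.sum_range]
    exact Finset.sum_congr rfl fun i _ => by rw [pad_fin]
  rw [e, ← Finset.sum_filter]
  symm
  apply Finset.sum_subset
  · intro i hi; simp at hi ⊢; exact hi.2
  · intro i hi hi'
    simp only [Finset.mem_range, Finset.mem_filter, not_and] at hi hi'
    simp only [pad]
    rw [dif_neg]
    intro h
    exact hi' h hi

lemma cone_zero (l : ℕ) : Cone l 0 (vdm l) :=
  ⟨{0}, by simpa using isP_zero l, by simp, by simp [vdm_eq]; rfl⟩

/-- Let `A ≻ B` be partitions of length at most `l` of equal weight at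
distance `|Y(A) \ Y(B)| = k`, and `f` a subdivision of `{1,…,l}`. Then `k·G_J(A) + B` has
positive multiplicity in `(s_A)^{k·L(l)+1}`. -/
theorem kGJ_add_B_in_schur_power (l ι k : ℕ) (hl : 0 < l) (A B : Fin l → ℕ)
    (hA : Antitone A) (hB : Antitone B) (hw : ∑ i, A i = ∑ i, B i)
    (hdom : Dom l A B) (hne : A ≠ B) (hk : (YD l A \ YD l B).ncard = k)
    (f : Fin l → Fin ι) (hf : Monotone f) (hsurj : Function.Surjective f) :
    0 < schurMult l (fun i => k * GJ l ι f A i + B i)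
      ((schur l A) ^ (k * Lnum l + 1)) := by
  have hAP := pad_isP hA
  have hBP := pad_isP hB
  have hk' : ∑ i ∈ range l, (pad l A i - pad l B i) = k := by
    rw [← hk, ncard_YD, Finset.sum_range]
    exact Finset.sum_congr rfl fun i _ => by rw [pad_fin, pad_fin]
  have h2 := main_ind f hf hAP hBP k (pad l A) hAP (by rw [ps_pad_l, ps_pad_l, hw])
    (fun i => by rw [ps_pad, ps_pad]; exact hdom i) (fun _ _ => le_rfl) (fun _ _ => le_rfl) hk'
  have h3 := reach_trans (reach_one _ hAP) h2
  have h4 := cone_coeff (reach_cone A (pad l A) (pad_fin A) hA h3 (cone_zero l))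
  have hG : ∀ i : Fin l, Gx l ι f (pad l A) i = GJ l ι f A i := by
    intro i
    rw [Gx, pad_fin]
    congr 1
    funext j
    exact pad_fin A j
  rw [schurMult, add_comm (k * Lnum l) 1]
  convert h4 using 5 with i
  simp only [Pi.add_apply, pad_fin, hG]
  ring
end

section
/- Let J be a subdivision of {1,…,l} into consecutive intervals I_1,…,I_ι, and let B, C be partitions of length at most l. For each j = 1,…,ι let A_j be a partition of length |I_j| with positive Littlewood–Richardson coefficient c^{A_j}_{B[I_j], C[I_j]} > 0. Then the concatenation A_1∘⋯∘A_ι is a partition of length at most l, and its Littlewood–Richardson coefficient c^{A_1∘⋯∘A_ι}_{B,C} is positive. -/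
open Finset MvPolynomial

/-- The restriction `A[I_j]` of `A` to block `I_j`, written as a length-`l` tuple (the
entries of `A` on `I_j` in order, followed by zeros). -/
def restr (l ι : ℕ) (f : Fin l → Fin ι) (A : Fin l → ℕ) (j : Fin ι) : Fin l → ℕ :=
  fun i => if (i : ℕ) < bsize l ι f j then pad l A (bstart l ι f j + (i : ℕ)) else 0

/-! ### Bialternant formula -/

/-- General alternant `det (x_i ^ α_j)`. -/
noncomputable def altP (l : ℕ) (α : Fin l → ℕ) : MvPolynomial (Fin l) ℤ :=
  Matrix.det (Matrix.of fun i j : Fin l => (X i : MvPolynomial (Fin l) ℤ) ^ α j)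

/-- The staircase. -/
def stair (l : ℕ) (i : Fin l) : ℕ := l - 1 - (i : ℕ)

lemma vdm_eq_s15 (l : ℕ) : vdm l = altP l (stair l) := rfl

/-- geometric series in `x_i T`. -/
noncomputable def geo (l : ℕ) (i : Fin l) : PowerSeries (MvPolynomial (Fin l) ℤ) :=
  PowerSeries.mk fun n => X i ^ n

lemma geo_mul (l : ℕ) (i : Fin l) :
    geo l i * (1 - PowerSeries.C (X i : MvPolynomial (Fin l) ℤ) * PowerSeries.X) = 1 := by
  ext n : 1
  rw [mul_sub, mul_one, ← mul_assoc, map_sub]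
  cases n with
  | zero => simp [geo]
  | succ n =>
    rw [PowerSeries.coeff_succ_mul_X, PowerSeries.coeff_mul_C]
    simp [geo, pow_succ, PowerSeries.coeff_one]

lemma coeff_prod_geo (l n : ℕ) :
    PowerSeries.coeff n (∏ i, geo l i) = hsymm (Fin l) ℤ n := by
  rw [PowerSeries.coeff_prod, hsymm]
  symm
  refine Finset.sum_bij' (fun s _ => Multiset.toFinsupp s.1)
    (fun d hd => ⟨Finsupp.toMultiset d, ?_⟩) ?_ ?_ ?_ ?_ ?_
  · rw [Finsupp.card_toMultiset]
    have := (mem_finsuppAntidiag.1 hd).1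
    rw [Finsupp.sum_fintype _ _ (by simp)]
    simpa using this
  · intro s _
    rw [mem_finsuppAntidiag]
    refine ⟨?_, Finset.subset_univ _⟩
    change ∑ i, Multiset.count i s.1 = n
    rw [Multiset.sum_count_eq_card (by simp)]
    exact s.2
  · intro d hd
    exact mem_univ _
  · intro s _
    apply Subtype.ext
    simp
  · intro d hd
    simp
  · intro s _
    simp only [geo, PowerSeries.coeff_mk, Multiset.toFinsupp_apply]
    rw [Finset.prod_multiset_map_count]
    refine Finset.prod_subset (Finset.subset_univ _) ?_
    intro x _ hx
    rw [Multiset.count_eq_zero_of_notMem (by simpa using hx), pow_zero]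

/-- `∏_{j ≠ i} (1 - x_j T)`. -/
noncomputable def elemP (l : ℕ) (i : Fin l) : Polynomial (MvPolynomial (Fin l) ℤ) :=
  ∏ j ∈ univ.erase i, (1 - Polynomial.C (X j) * Polynomial.X)

lemma elemP_natDegree (l : ℕ) (i : Fin l) : (elemP l i).natDegree ≤ l - 1 := by
  refine (Polynomial.natDegree_prod_le _ _).trans ?_
  refine (Finset.sum_le_card_nsmul _ _ 1 ?_).trans ?_
  · intro j _
    compute_degree
  · simp

lemma geo_eq (l : ℕ) (i : Fin l) :
    geo l i = (∏ i, geo l i) * (elemP l i : PowerSeries (MvPolynomial (Fin l) ℤ)) := by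
  have h : (elemP l i : PowerSeries (MvPolynomial (Fin l) ℤ)) =
      ∏ j ∈ univ.erase i, (1 - PowerSeries.C (X j) * PowerSeries.X) := by
    rw [elemP]
    rw [← Polynomial.coeToPowerSeries.ringHom_apply, map_prod]
    refine Finset.prod_congr rfl fun j _ => ?_
    simp
  rw [h, ← Finset.mul_prod_erase univ _ (mem_univ i), mul_assoc, ← Finset.prod_mul_distrib,
    Finset.prod_congr rfl (fun j _ => geo_mul l j)]
  simp

lemma pow_eq_sum (l : ℕ) (i : Fin l) (m : ℕ) :
    (X i : MvPolynomial (Fin l) ℤ) ^ m =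
      ∑ r : Fin l, hp l ((m : ℤ) - (l - 1 : ℕ) + (r : ℕ)) * (elemP l i).coeff (l - 1 - r) := by
  have hl : 0 < l := i.pos
  have h := congrArg (PowerSeries.coeff m) (geo_eq l i)
  rw [PowerSeries.coeff_mul] at h
  simp only [coeff_prod_geo, Polynomial.coeff_coe] at h
  simp only [geo, PowerSeries.coeff_mk] at h
  rw [h, Finset.Nat.sum_antidiagonal_eq_sum_range_succ_mk]
  simp only
  -- both sides as sums over b
  have e1 : ∑ r : Fin l, hp l ((m : ℤ) - (l - 1 : ℕ) + (r : ℕ)) * (elemP l i).coeff (l - 1 - r)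
      = ∑ b ∈ range l, hp l ((m : ℤ) - b) * (elemP l i).coeff b := by
    rw [← Fin.sum_univ_eq_sum_range (fun b => hp l ((m : ℤ) - b) * (elemP l i).coeff b)]
    refine Fintype.sum_equiv Fin.revPerm _ _ fun r => ?_
    have : ((Fin.revPerm r : Fin l) : ℕ) = l - 1 - r := by
      simp [Fin.val_rev]; omega
    rw [this]
    congr 2
    have := r.2
    omega
  have e2 : ∑ k ∈ range m.succ, hsymm (Fin l) ℤ k * (elemP l i).coeff (m - k)
      = ∑ b ∈ range m.succ, hp l ((m : ℤ) - b) * (elemP l i).coeff b := by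
    rw [← Finset.sum_range_reflect]
    refine Finset.sum_congr rfl fun b hb => ?_
    have hb' : b ≤ m := by simpa [Nat.lt_succ_iff] using hb
    have h1 : m.succ - 1 - b = m - b := by omega
    rw [h1, hp, if_pos (by omega)]
    congr 2
    · omega
    · omega
  rw [e1, e2]
  have e3 : ∀ N, m.succ ≤ N → l ≤ N → 
      ∑ b ∈ range m.succ, hp l ((m : ℤ) - b) * (elemP l i).coeff b 
        = ∑ b ∈ range N, hp l ((m : ℤ) - b) * (elemP l i).coeff b ∧
      ∑ b ∈ range l, hp l ((m : ℤ) - b) * (elemP l i).coeff b 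
        = ∑ b ∈ range N, hp l ((m : ℤ) - b) * (elemP l i).coeff b := by
    intro N h1 h2
    constructor
    · refine Finset.sum_subset (Finset.range_mono h1) fun b _ hb => ?_
      rw [Finset.mem_range] at hb
      rw [hp, if_neg (by omega), zero_mul]
    · refine Finset.sum_subset (Finset.range_mono h2) fun b _ hb => ?_
      rw [Finset.mem_range] at hb
      rw [Polynomial.coeff_eq_zero_of_natDegree_lt, mul_zero]
      have := elemP_natDegree l i
      omega
  obtain ⟨h1, h2⟩ := e3 (max m.succ l) (le_max_left _ _) (le_max_right _ _)
  rw [h1, h2]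

lemma schur_mul_aux (l : ℕ) (A : Fin l → ℕ) :
    schur l A * Matrix.det (Matrix.of fun r i : Fin l => (elemP l i).coeff (l - 1 - r))
      = altP l (fun i => A i + stair l i) := by
  rw [schur, ← Matrix.det_mul, altP, ← Matrix.det_transpose (Matrix.of fun i j : Fin l => _)]
  congr 1
  ext1 j i
  rw [Matrix.mul_apply, Matrix.transpose_apply, Matrix.of_apply, pow_eq_sum]
  refine Finset.sum_congr rfl fun r _ => ?_
  simp only [Matrix.of_apply]
  congr 2
  have := j.2
  simp only [stair]
  omega

lemma schur_zero (l : ℕ) : schur l (fun _ => 0) = 1 := by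
  rw [schur, Matrix.det_of_isUpperTriangular]
  · refine Finset.prod_eq_one fun i _ => ?_
    simp [hp]
  · intro i j hij
    simp only [id] at hij
    rw [Matrix.of_apply, hp, if_neg]
    have : (j : ℕ) < i := hij
    push_cast
    omega

lemma schur_mul_vdm (l : ℕ) (A : Fin l → ℕ) :
    schur l A * vdm l = altP l (fun i => A i + stair l i) := by
  have h := schur_mul_aux l (fun _ => 0)
  rw [schur_zero, one_mul] at h
  rw [← schur_mul_aux, h, vdm_eq_s15]
  simp

/-! ### Weights and top components -/

/-- integer weight of an exponent vector -/
def wt {l : ℕ} (w : Fin l → ℤ) (d : Fin l →₀ ℕ) : ℤ := ∑ i, w i * (d i : ℤ)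

lemma wt_add {l : ℕ} (w : Fin l → ℤ) (d e : Fin l →₀ ℕ) : wt w (d + e) = wt w d + wt w e := by
  simp [wt, mul_add, Finset.sum_add_distrib]

/-- All monomials of `P` have weight at most `N`. -/
def WLe {l : ℕ} (w : Fin l → ℤ) (N : ℤ) (P : MvPolynomial (Fin l) ℤ) : Prop :=
  ∀ d, coeff d P ≠ 0 → wt w d ≤ N

/-- weight `N` component -/
noncomputable def comp {l : ℕ} (w : Fin l → ℤ) (N : ℤ) :
    MvPolynomial (Fin l) ℤ →ₗ[ℤ] MvPolynomial (Fin l) ℤ :=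
  weightedHomogeneousComponent w N

lemma coeff_comp {l : ℕ} (w : Fin l → ℤ) (N : ℤ) (P : MvPolynomial (Fin l) ℤ) (d : Fin l →₀ ℕ) :
    coeff d (comp w N P) = if wt w d = N then coeff d P else 0 := by
  rw [comp, coeff_weightedHomogeneousComponent]
  have : Finsupp.weight w d = wt w d := by
    rw [Finsupp.weight_apply, Finsupp.sum_fintype _ _ (by simp), wt]
    refine Finset.sum_congr rfl fun i _ => ?_
    simp [mul_comm]
  rw [this]

lemma WLe.mul {l : ℕ} {w : Fin l → ℤ} {a b : ℤ} {P Q : MvPolynomial (Fin l) ℤ}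
    (hP : WLe w a P) (hQ : WLe w b Q) : WLe w (a + b) (P * Q) := by
  intro d hd
  rw [coeff_mul] at hd
  obtain ⟨x, hx, hne⟩ := Finset.exists_ne_zero_of_sum_ne_zero hd
  rw [HasAntidiagonal.mem_antidiagonal] at hx
  rw [← hx, wt_add]
  exact add_le_add (hP _ (left_ne_zero_of_mul hne)) (hQ _ (right_ne_zero_of_mul hne))

lemma comp_mul {l : ℕ} {w : Fin l → ℤ} {a b : ℤ} {P Q : MvPolynomial (Fin l) ℤ}
    (hP : WLe w a P) (hQ : WLe w b Q) : comp w (a + b) (P * Q) = comp w a P * comp w b Q := by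
  ext d
  rw [coeff_comp, coeff_mul, coeff_mul]
  simp only [coeff_comp]
  split_ifs with h
  · refine Finset.sum_congr rfl fun x hx => ?_
    rw [HasAntidiagonal.mem_antidiagonal] at hx
    rw [← hx, wt_add] at h
    by_cases h1 : coeff x.1 P = 0
    · simp [h1]
    by_cases h2 : coeff x.2 Q = 0
    · simp [h2]
    have := hP _ h1
    have := hQ _ h2
    rw [if_pos (by omega), if_pos (by omega)]
  · symm
    refine Finset.sum_eq_zero fun x hx => ?_
    rw [HasAntidiagonal.mem_antidiagonal] at hx
    rw [← hx, wt_add] at h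
    by_cases h1 : wt w x.1 = a
    · rw [if_neg (c := wt w x.2 = b) (by omega), mul_zero]
    · rw [if_neg (c := wt w x.1 = a) (by omega), zero_mul]

lemma WLe.cancel {l : ℕ} {w : Fin l → ℤ} {a b : ℤ} {P Q : MvPolynomial (Fin l) ℤ}
    (hPQ : WLe w (a + b) (P * Q)) (hQ : WLe w b Q) (hQ0 : comp w b Q ≠ 0) : WLe w a P := by
  intro d hd
  by_contra hlt
  push Not at hlt
  obtain ⟨e, he, hmax⟩ := P.support.exists_max_image (wt w) ⟨d, by simpa using hd⟩
  have hP : WLe w (wt w e) P := fun x hx => hmax x (by simpa using hx)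
  have h1 := comp_mul hP hQ
  have h2 : comp w (wt w e + b) (P * Q) = 0 := by
    ext x
    rw [coeff_comp]
    split_ifs with h
    · by_contra hne
      have := hPQ x hne
      have := hmax d (by simpa using hd)
      omega
    · simp
  rw [h2] at h1
  have h3 : comp w (wt w e) P ≠ 0 := by
    intro h
    have := congrArg (coeff e) h
    rw [coeff_comp, if_pos rfl] at this
    simp at this
    simp at he
    exact he this
  exact mul_ne_zero h3 hQ0 h1.symm

/-! ### Alternants -/

/-- exponent vector from a function -/
noncomputable abbrev ex {l : ℕ} (α : Fin l → ℕ) : Fin l →₀ ℕ := Finsupp.equivFunOnFinite.symm α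

lemma altP_eq (l : ℕ) (α : Fin l → ℕ) :
    altP l α = ∑ σ : Equiv.Perm (Fin l), (Equiv.Perm.sign σ : ℤ) •
      monomial (ex fun i => α (σ⁻¹ i)) (1 : ℤ) := by
  rw [altP, Matrix.det_apply]
  refine Finset.sum_congr rfl fun σ _ => ?_
  have : ∏ i, (Matrix.of fun i j : Fin l => (X i : MvPolynomial (Fin l) ℤ) ^ α j) (σ i) i
      = monomial (ex fun i => α (σ⁻¹ i)) (1 : ℤ) := by
    rw [monomial_eq, Finsupp.prod_fintype _ _ (by simp)]
    simp only [Matrix.of_apply, C_1, one_mul]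
    refine Fintype.prod_equiv σ _ _ fun i => ?_
    simp
  rw [this]
  rfl

lemma wt_perm {l : ℕ} (w : Fin l → ℤ) (α : Fin l → ℕ) (σ : Equiv.Perm (Fin l)) :
    wt w (ex fun i => α (σ⁻¹ i)) = ∑ i, w (σ i) * (α i : ℤ) := by
  rw [wt]
  symm
  refine Fintype.sum_equiv σ _ _ fun i => ?_
  simp

lemma monovary_aux {l : ℕ} {w : Fin l → ℤ} {α : Fin l → ℕ} (hw : Antitone w) (hα : Antitone α) :
    Monovary w (fun i => (α i : ℤ)) := by
  intro i j hij
  have hij' : α i < α j := by simpa using hij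
  refine hw ?_
  by_contra h
  push Not at h
  exact absurd (hα h.le) (by omega)

lemma altP_WLe {l : ℕ} {w : Fin l → ℤ} {α : Fin l → ℕ} (hw : Antitone w) (hα : Antitone α) :
    WLe w (∑ i, w i * (α i : ℤ)) (altP l α) := by
  intro d hd
  rw [altP_eq, coeff_sum] at hd
  obtain ⟨σ, _, hσ⟩ := Finset.exists_ne_zero_of_sum_ne_zero hd
  rw [coeff_smul, coeff_monomial] at hσ
  have hd : (ex fun i => α (σ⁻¹ i)) = d := by
    by_contra h
    rw [if_neg h] at hσ
    simp at hσ
  rw [← hd, wt_perm]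
  exact (monovary_aux hw hα).sum_comp_perm_mul_le_sum_mul

lemma coeff_altP {l : ℕ} {α : Fin l → ℕ} (hα : Function.Injective α) :
    coeff (ex α) (altP l α) = 1 := by
  rw [altP_eq, coeff_sum, Finset.sum_eq_single 1]
  · simp
  · intro σ _ hσ
    rw [coeff_smul, coeff_monomial, if_neg, smul_zero]
    intro h
    apply hσ
    ext i
    have := DFunLike.congr_fun h (σ i)
    simp at this
    rw [← hα this]
    simp
  · simp

lemma comp_altP {l ι : ℕ} {f : Fin l → Fin ι} (hf : Monotone f) {α : Fin l → ℕ}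
    (hα : StrictAnti α) :
    comp (fun i => -((f i : ℕ) : ℤ)) (∑ i, -((f i : ℕ) : ℤ) * (α i : ℤ)) (altP l α)
      = Matrix.det (Matrix.of fun i j : Fin l =>
          if f i = f j then (X i : MvPolynomial (Fin l) ℤ) ^ α j else 0) := by
  set w : Fin l → ℤ := fun i => -((f i : ℕ) : ℤ) with hw
  have hwa : Antitone w := by
    intro i j hij
    have : (f i : ℕ) ≤ f j := hf hij
    simp only [hw]
    omega
  rw [altP_eq, map_sum, Matrix.det_apply]
  refine Finset.sum_congr rfl fun σ _ => ?_
  rw [map_smul]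
  have key : comp w (∑ i, w i * (α i : ℤ)) (monomial (ex fun i => α (σ⁻¹ i)) (1 : ℤ)) =
      ∏ i, (Matrix.of fun i j : Fin l =>
          if f i = f j then (X i : MvPolynomial (Fin l) ℤ) ^ α j else 0) (σ i) i := by
    by_cases h : ∀ i, f (σ i) = f i
    · have h1 : ∏ i, (Matrix.of fun i j : Fin l =>
          if f i = f j then (X i : MvPolynomial (Fin l) ℤ) ^ α j else 0) (σ i) i
          = monomial (ex fun i => α (σ⁻¹ i)) (1 : ℤ) := by
        rw [monomial_eq, Finsupp.prod_fintype _ _ (by simp)]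
        simp only [Matrix.of_apply, C_1, one_mul]
        refine Fintype.prod_equiv σ _ _ fun i => ?_
        simp [h]
      rw [h1]
      ext d
      rw [coeff_comp]
      split_ifs with h2
      · rfl
      · rw [coeff_monomial, if_neg]
        rintro rfl
        apply h2
        rw [wt_perm]
        simp [hw, h]
    · have h1 : ∏ i, (Matrix.of fun i j : Fin l =>
          if f i = f j then (X i : MvPolynomial (Fin l) ℤ) ^ α j else 0) (σ i) i = 0 := by
        push Not at h
        obtain ⟨i, hi⟩ := h
        refine Finset.prod_eq_zero (mem_univ i) ?_
        simp [hi]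
      rw [h1]
      ext d
      rw [coeff_comp]
      split_ifs with h2
      · rw [coeff_monomial, if_neg]
        · simp
        rintro rfl
        rw [wt_perm] at h2
        have h3 := (monovary_aux hwa hα.antitone).sum_comp_perm_mul_eq_sum_mul_iff.1 h2
        apply h
        have h4 : Monotone (f ∘ σ) := by
          intro i j hij
          rcases hij.eq_or_lt with rfl | hlt
          · exact le_rfl
          have h5 : w (σ j) ≤ w (σ i) := h3 (i := j) (j := i) (by simpa using hα hlt)
          simp only [hw] at h5
          change (f (σ i) : ℕ) ≤ f (σ j)
          omega
        have h6 := Tuple.unique_monotone (f := f) (σ := σ) (τ := 1) h4 (by simpa using hf)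
        intro i
        simpa using congrFun h6 i
      · simp
  rw [key]
  rfl

lemma stair_strictAnti (l : ℕ) : StrictAnti (stair l) := by
  intro i j hij
  have : (i : ℕ) < j := hij
  have := j.2
  simp only [stair]
  omega

lemma add_stair {l : ℕ} {A : Fin l → ℕ} (hA : Antitone A) :
    StrictAnti (fun i => A i + stair l i) := by
  intro i j hij
  have h1 := stair_strictAnti l hij
  have h2 := hA hij.le
  simp only
  omega

lemma comp_vdm_ne {l : ℕ} (w : Fin l → ℤ) :
    comp w (∑ i, w i * (stair l i : ℤ)) (vdm l) ≠ 0 := by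
  intro h
  have h1 := congrArg (coeff (ex (stair l))) h
  rw [coeff_comp, if_pos (by simp [wt]), vdm_eq_s15, coeff_altP (stair_strictAnti l).injective] at h1
  simp at h1

lemma vdm_WLe {l : ℕ} {w : Fin l → ℤ} (hw : Antitone w) :
    WLe w (∑ i, w i * (stair l i : ℤ)) (vdm l) :=
  altP_WLe hw (stair_strictAnti l).antitone

lemma schur_WLe {l : ℕ} {w : Fin l → ℤ} (hw : Antitone w) {A : Fin l → ℕ} (hA : Antitone A) :
    WLe w (∑ i, w i * (A i : ℤ)) (schur l A) := by
  refine WLe.cancel (b := ∑ i, w i * (stair l i : ℤ)) (Q := vdm l) ?_ (vdm_WLe hw) (comp_vdm_ne w)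
  rw [schur_mul_vdm]
  convert altP_WLe hw (add_stair hA).antitone using 1
  rw [← Finset.sum_add_distrib]
  refine Finset.sum_congr rfl fun i _ => ?_
  push_cast
  ring

lemma lrCoeff_eq (l : ℕ) (B C A : Fin l → ℕ) : 
    lrCoeff l B C A = coeff (ex fun i => A i + stair l i) (schur l B * schur l C * vdm l) := rfl

lemma prod_WLe {l : ℕ} {w : Fin l → ℤ} (hw : Antitone w) {B C : Fin l → ℕ} (hB : Antitone B)
    (hC : Antitone C) :
    WLe w (∑ i, w i * (B i : ℤ) + ∑ i, w i * (C i : ℤ) + ∑ i, w i * (stair l i : ℤ))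
      (schur l B * schur l C * vdm l) :=
  ((schur_WLe hw hB).mul (schur_WLe hw hC)).mul (vdm_WLe hw)

lemma wt_ex_add {l : ℕ} (w : Fin l → ℤ) (A : Fin l → ℕ) :
    wt w (ex fun i => A i + stair l i) = ∑ i, w i * (A i : ℤ) + ∑ i, w i * (stair l i : ℤ) := by
  rw [wt, ← Finset.sum_add_distrib]
  refine Finset.sum_congr rfl fun i _ => ?_
  simp
  ring

lemma weyl {l : ℕ} {B C A : Fin l → ℕ} (hB : Antitone B) (hC : Antitone C)
    (h : lrCoeff l B C A ≠ 0) {w : Fin l → ℤ} (hw : Antitone w) :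
    ∑ i, w i * (A i : ℤ) ≤ ∑ i, w i * (B i : ℤ) + ∑ i, w i * (C i : ℤ) := by
  rw [lrCoeff_eq] at h
  have := prod_WLe hw hB hC _ h
  rw [wt_ex_add] at this
  omega

lemma lrCoeff_zero (l : ℕ) : lrCoeff l (fun _ => 0) (fun _ => 0) (fun _ => 0) = 1 := by
  rw [lrCoeff_eq, schur_zero, one_mul, one_mul, vdm_eq_s15]
  simp only [zero_add]
  exact coeff_altP (stair_strictAnti l).injective

/-! ### Blocks -/

lemma lower_iff {l : ℕ} (p : Fin l → Prop) [DecidablePred p] (hp : ∀ i j, i ≤ j → p j → p i)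
    (i : Fin l) : p i ↔ (i : ℕ) < (univ.filter p).card := by
  constructor
  · intro h
    have : Finset.Iic i ⊆ univ.filter p := by
      intro j hj
      simp only [Finset.mem_filter, mem_univ, true_and]
      exact hp j i (Finset.mem_Iic.1 hj) h
    have := Finset.card_le_card this
    rw [Fin.card_Iic] at this
    omega
  · intro h
    by_contra hn
    have : univ.filter p ⊆ Finset.Iio i := by
      intro j hj
      simp only [Finset.mem_filter, mem_univ, true_and] at hj
      rw [Finset.mem_Iio]
      by_contra hlt
      push Not at hlt
      exact hn (hp i j hlt hj)
    have := Finset.card_le_card this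
    rw [Fin.card_Iio] at this
    omega

lemma f_lt_iff {l ι : ℕ} {f : Fin l → Fin ι} (hf : Monotone f) (k : Fin ι) (i : Fin l) :
    f i < k ↔ (i : ℕ) < bstart l ι f k :=
  lower_iff (fun i => f i < k) (fun _ _ h h' => (hf h).trans_lt h') i

lemma bend_eq {l ι : ℕ} (f : Fin l → Fin ι) (k : Fin ι) :
    bend l ι f k = bstart l ι f k + bsize l ι f k := by
  rw [bend, bstart, bsize, ← Finset.card_union_of_disjoint]
  · congr 1
    ext i
    simp [le_iff_lt_or_eq]
  · rw [Finset.disjoint_filter]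
    intro i _ h
    exact h.ne

lemma f_le_iff {l ι : ℕ} {f : Fin l → Fin ι} (hf : Monotone f) (k : Fin ι) (i : Fin l) :
    f i ≤ k ↔ (i : ℕ) < bstart l ι f k + bsize l ι f k := by
  rw [← bend_eq]
  exact lower_iff (fun i => f i ≤ k) (fun _ _ h h' => (hf h).trans h') i

lemma f_eq_iff {l ι : ℕ} {f : Fin l → Fin ι} (hf : Monotone f) (k : Fin ι) (i : Fin l) :
    f i = k ↔ bstart l ι f k ≤ i ∧ (i : ℕ) < bstart l ι f k + bsize l ι f k := by
  rw [← f_le_iff hf, le_antisymm_iff, and_comm, ← not_lt, f_lt_iff hf, not_lt]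

lemma bend_le {l ι : ℕ} (f : Fin l → Fin ι) (k : Fin ι) :
    bstart l ι f k + bsize l ι f k ≤ l := by
  rw [← bend_eq]
  exact (Finset.card_le_univ _).trans (by simp)

/-- embedding of block `k` -/
def bmap {l ι : ℕ} (f : Fin l → Fin ι) (k : Fin ι) (i : Fin (bsize l ι f k)) : Fin l :=
  ⟨bstart l ι f k + i, by have := bend_le f k; have := i.2; omega⟩

lemma f_bmap {l ι : ℕ} {f : Fin l → Fin ι} (hf : Monotone f) (k : Fin ι)
    (i : Fin (bsize l ι f k)) : f (bmap f k i) = k := by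
  rw [f_eq_iff hf]
  have := i.2
  simp only [bmap]
  omega

/-- block `k` as a fiber -/
def bequiv {l ι : ℕ} {f : Fin l → Fin ι} (hf : Monotone f) (k : Fin ι) :
    Fin (bsize l ι f k) ≃ {i // f i = k} where
  toFun i := ⟨bmap f k i, f_bmap hf k i⟩
  invFun i := ⟨i.1 - bstart l ι f k, by
    have := (f_eq_iff hf k i.1).1 i.2
    omega⟩
  left_inv i := by
    ext
    simp [bmap]
  right_inv i := by
    have := (f_eq_iff hf k i.1).1 i.2
    apply Subtype.ext
    apply Fin.ext
    simp only [bmap]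
    omega

/-- all blocks together -/
def ball {l ι : ℕ} {f : Fin l → Fin ι} (hf : Monotone f) :
    (Σ k : Fin ι, Fin (bsize l ι f k)) ≃ Fin l :=
  (Equiv.sigmaCongrRight (bequiv hf)).trans (Equiv.sigmaFiberEquiv f)

lemma ball_apply {l ι : ℕ} {f : Fin l → Fin ι} (hf : Monotone f) (k : Fin ι)
    (i : Fin (bsize l ι f k)) : ball hf ⟨k, i⟩ = bmap f k i := rfl

lemma sum_blocks {l ι : ℕ} {f : Fin l → Fin ι} (hf : Monotone f) (g : Fin l → ℤ) :
    ∑ i, g i = ∑ k, ∑ i, g (bmap f k i) := by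
  rw [← (ball hf).sum_comp, Fintype.sum_sigma]
  rfl

lemma det_blocks {l ι : ℕ} {f : Fin l → Fin ι} (hf : Monotone f) (α : Fin l → ℕ) :
    Matrix.det (Matrix.of fun i j : Fin l =>
          if f i = f j then (X i : MvPolynomial (Fin l) ℤ) ^ α j else 0) =
    ∏ k, rename (bmap f k) (altP (bsize l ι f k) (fun i => α (bmap f k i))) := by
  rw [Matrix.BlockTriangular.det_fintype (b := f)]
  · refine Finset.prod_congr rfl fun k _ => ?_
    rw [altP, ← Matrix.det_submatrix_equiv_self (bequiv hf k)]
    rw [AlgHom.map_det]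
    congr 1
    ext1 i j
    simp [Matrix.toSquareBlock, Matrix.toSquareBlockProp_def, bequiv, f_bmap hf]
  · intro i j hij
    simp [hij.ne']

/-- all-ones monomial power -/
noncomputable def allX (b c : ℕ) : MvPolynomial (Fin b) ℤ := monomial (ex fun _ => c) 1

lemma allX_eq (b c : ℕ) : allX b c = ∏ i, X i ^ c := by
  rw [allX, monomial_eq, Finsupp.prod_fintype _ _ (by simp)]
  simp

lemma altP_shift (b c : ℕ) (α : Fin b → ℕ) :
    altP b (fun i => α i + c) = allX b c * altP b α := by
  rw [altP, altP, allX_eq, ← Matrix.det_mul_column]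
  congr 1
  ext1 i j
  simp [pow_add, mul_comm]

lemma coeff_allX (b c : ℕ) (α : Fin b → ℕ) (P : MvPolynomial (Fin b) ℤ) :
    coeff (ex fun i => α i + c) (allX b c * P) = coeff (ex α) P := by
  have : (ex fun i => α i + c) = (ex fun _ : Fin b => c) + ex α := by
    ext i
    simp [add_comm]
  rw [this, allX, coeff_monomial_mul, one_mul]

/-- block restriction, unpadded -/
def blk {l ι : ℕ} (f : Fin l → Fin ι) (A : Fin l → ℕ) (k : Fin ι) : Fin (bsize l ι f k) → ℕ :=
  fun i => A (bmap f k i)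

/-- number of positions after block `k` -/
def baft {l ι : ℕ} (f : Fin l → Fin ι) (k : Fin ι) : ℕ :=
  l - (bstart l ι f k + bsize l ι f k)

lemma stair_bmap {l ι : ℕ} (f : Fin l → Fin ι) (k : Fin ι) (i : Fin (bsize l ι f k)) :
    stair l (bmap f k i) = stair _ i + baft f k := by
  have := bend_le f k
  have := i.2
  simp only [stair, bmap, baft]
  omega

lemma comp_alt_blocks {l ι : ℕ} {f : Fin l → Fin ι} (hf : Monotone f) {A : Fin l → ℕ}
    (hA : Antitone A) :
    comp (fun i => -((f i : ℕ) : ℤ))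
      (∑ i, -((f i : ℕ) : ℤ) * (A i : ℤ) + ∑ i, -((f i : ℕ) : ℤ) * (stair l i : ℤ))
      (schur l A * vdm l)
      = ∏ k, rename (bmap f k) (allX _ (baft f k) * (schur _ (blk f A k) * vdm _)) := by
  rw [schur_mul_vdm]
  have h := comp_altP hf (add_stair hA)
  rw [det_blocks hf] at h
  convert h using 1
  · congr 1
    rw [← Finset.sum_add_distrib]
    congr 1
    refine Finset.sum_congr rfl fun i _ => ?_
    push_cast
    ring
  · refine Finset.prod_congr rfl fun k _ => ?_
    rw [schur_mul_vdm, ← altP_shift]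
    simp only [stair_bmap, blk, add_assoc]

lemma antitone_w {l ι : ℕ} {f : Fin l → Fin ι} (hf : Monotone f) :
    Antitone (fun i => -((f i : ℕ) : ℤ)) := by
  intro i j hij
  have : (f i : ℕ) ≤ f j := hf hij
  simp only
  omega

lemma comp_vdm_blocks {l ι : ℕ} {f : Fin l → Fin ι} (hf : Monotone f) :
    comp (fun i => -((f i : ℕ) : ℤ)) (∑ i, -((f i : ℕ) : ℤ) * (stair l i : ℤ)) (vdm l)
      = ∏ k, rename (bmap f k) (allX _ (baft f k) * vdm _) := by
  have h := comp_alt_blocks hf (A := fun _ => 0) (fun _ _ _ => le_rfl)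
  rw [schur_zero, one_mul] at h
  have hs : ∀ k, schur _ (blk f (fun _ => 0) k) = 1 := fun k => schur_zero _
  simpa [hs] using h

lemma comp_schur_blocks {l ι : ℕ} {f : Fin l → Fin ι} (hf : Monotone f) {A : Fin l → ℕ}
    (hA : Antitone A) :
    comp (fun i => -((f i : ℕ) : ℤ)) (∑ i, -((f i : ℕ) : ℤ) * (A i : ℤ)) (schur l A)
      = ∏ k, rename (bmap f k) (schur _ (blk f A k)) := by
  have h := comp_alt_blocks hf hA
  rw [comp_mul (schur_WLe (antitone_w hf) hA) (vdm_WLe (antitone_w hf))] at h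
  apply mul_right_cancel₀ (comp_vdm_ne (l := l) (fun i => -((f i : ℕ) : ℤ)))
  rw [h, comp_vdm_blocks hf, ← Finset.prod_mul_distrib]
  refine Finset.prod_congr rfl fun k _ => ?_
  simp only [map_mul]
  ring

lemma coeff_prod_rename {l ι : ℕ} {f : Fin l → Fin ι} (hf : Monotone f)
    (Q : ∀ k, MvPolynomial (Fin (bsize l ι f k)) ℤ) (d : Fin l → ℕ) :
    coeff (ex d) (∏ k, rename (bmap f k) (Q k)) = ∏ k, coeff (ex fun i => d (bmap f k i)) (Q k) := by
  have inj : ∀ k k' i i', bmap f k i = bmap f k' i' → 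
      (⟨k, i⟩ : Σ k : Fin ι, Fin (bsize l ι f k)) = ⟨k', i'⟩ := by
    intro k k' i i' h
    exact (ball hf).injective h
  have hinj : ∀ k, Function.Injective (bmap f k) := by
    intro k i i' h
    simpa using inj _ _ _ _ h
  have hval : ∀ (p : ∀ k, Fin (bsize l ι f k) →₀ ℕ) k i,
      (∑ k, Finsupp.mapDomain (bmap f k) (p k)) (bmap f k i) = p k i := by
    intro p k i
    rw [Finsupp.finsetSum_apply, Finset.sum_eq_single k]
    · rw [Finsupp.mapDomain_apply (hinj k)]
    · intro k' _ hk'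
      rw [Finsupp.mapDomain_of_notMem_range]
      rintro ⟨i', h⟩
      have := congrArg Sigma.fst (inj _ _ _ _ h)
      exact hk' this
    · simp
  have e : ∏ k, rename (bmap f k) (Q k) =
      ∑ p ∈ Fintype.piFinset (fun k => (Q k).support),
        monomial (∑ k, Finsupp.mapDomain (bmap f k) (p k)) (∏ k, coeff (p k) (Q k)) := by
    have h1 : ∀ k, rename (bmap f k) (Q k) = ∑ p ∈ (Q k).support,
        monomial (Finsupp.mapDomain (bmap f k) p) (coeff p (Q k)) := by
      intro k
      conv_lhs => rw [(Q k).as_sum]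
      rw [map_sum]
      simp only [rename_monomial]
    simp only [h1]
    rw [Finset.prod_univ_sum]
    refine Finset.sum_congr rfl fun p _ => ?_
    have : ∀ t : Finset (Fin ι), ∏ k ∈ t, monomial (Finsupp.mapDomain (bmap f k) (p k))
        (coeff (p k) (Q k)) = monomial (∑ k ∈ t, Finsupp.mapDomain (bmap f k) (p k))
          (∏ k ∈ t, coeff (p k) (Q k)) := by
      intro t
      induction t using Finset.induction_on with
      | empty => simp
      | insert a t ha ih =>
        rw [Finset.prod_insert ha, ih, monomial_mul, Finset.sum_insert ha, Finset.prod_insert ha]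
    exact this univ
  rw [e, coeff_sum]
  rw [Finset.sum_eq_single (fun k => ex fun i => d (bmap f k i))]
  · rw [coeff_monomial, if_pos]
    ext x
    obtain ⟨⟨k, i⟩, rfl⟩ := (ball hf).surjective x
    rw [ball_apply, hval]
    simp
  · intro p _ hp
    rw [coeff_monomial, if_neg]
    intro h
    apply hp
    funext k
    ext i
    rw [← hval p k i, h]
    simp
  · intro h
    rw [Fintype.mem_piFinset] at h
    push Not at h
    obtain ⟨k, hk⟩ := h
    rw [coeff_monomial, Finset.prod_eq_zero (mem_univ k)]
    · simp
    · simpa using hk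

lemma lr_factor {l ι : ℕ} {f : Fin l → Fin ι} (hf : Monotone f) {B C A : Fin l → ℕ}
    (hB : Antitone B) (hC : Antitone C)
    (h : ∑ i, -((f i : ℕ) : ℤ) * (A i : ℤ) =
      ∑ i, -((f i : ℕ) : ℤ) * (B i : ℤ) + ∑ i, -((f i : ℕ) : ℤ) * (C i : ℤ)) :
    lrCoeff l B C A = ∏ k, lrCoeff _ (blk f B k) (blk f C k) (blk f A k) := by
  have hw := antitone_w hf
  have hc := comp_mul ((schur_WLe hw hB).mul (schur_WLe hw hC)) (vdm_WLe hw)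
  rw [comp_mul (schur_WLe hw hB) (schur_WLe hw hC), comp_schur_blocks hf hB,
    comp_schur_blocks hf hC, comp_vdm_blocks hf, ← Finset.prod_mul_distrib,
    ← Finset.prod_mul_distrib] at hc
  have hc' := congrArg (coeff (ex fun i => A i + stair l i)) hc
  rw [coeff_comp, if_pos (by rw [wt_ex_add, h])] at hc'
  rw [lrCoeff_eq, hc']
  simp only [← map_mul]
  rw [coeff_prod_rename hf]
  refine Finset.prod_congr rfl fun k _ => ?_
  rw [lrCoeff_eq]
  have hk := coeff_allX _ (baft f k) (fun i => blk f A k i + stair _ i)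
    (schur _ (blk f B k) * schur _ (blk f C k) * vdm _)
  rw [← hk]
  simp only [stair_bmap, blk, add_assoc]
  congr 1
  ring

/-! ### Assembling -/

lemma lrCoeff_congr {n m : ℕ} (h : n = m) {B C A : Fin n → ℕ} {B' C' A' : Fin m → ℕ}
    (hB : ∀ i, B i = B' (Fin.cast h i)) (hC : ∀ i, C i = C' (Fin.cast h i))
    (hA : ∀ i, A i = A' (Fin.cast h i)) : lrCoeff n B C A = lrCoeff m B' C' A' := by
  subst h
  obtain rfl : B = B' := funext hB
  obtain rfl : C = C' := funext hC
  obtain rfl : A = A' := funext hA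
  rfl

lemma restr_apply {l ι : ℕ} (f : Fin l → Fin ι) (A : Fin l → ℕ) (k : Fin ι) (i : Fin l)
    (hi : (i : ℕ) < bsize l ι f k) : restr l ι f A k i = blk f A k ⟨i, hi⟩ := by
  have := bend_le f k
  rw [restr, if_pos hi, pad, dif_pos (by omega)]
  rfl

lemma restr_zero {l ι : ℕ} (f : Fin l → Fin ι) (A : Fin l → ℕ) (k : Fin ι) (i : Fin l)
    (hi : ¬ (i : ℕ) < bsize l ι f k) : restr l ι f A k i = 0 := by
  rw [restr, if_neg hi]

lemma blk_antitone {l ι : ℕ} (f : Fin l → Fin ι) {A : Fin l → ℕ} (hA : Antitone A) (k : Fin ι) :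
    Antitone (blk f A k) := by
  intro i j hij
  apply hA
  have : (i : ℕ) ≤ j := hij
  change bstart l ι f k + (i : ℕ) ≤ bstart l ι f k + j
  omega

lemma restr_antitone {l ι : ℕ} (f : Fin l → Fin ι) {A : Fin l → ℕ} (hA : Antitone A) (k : Fin ι) :
    Antitone (restr l ι f A k) := by
  intro i j hij
  by_cases hj : (j : ℕ) < bsize l ι f k
  · have hi : (i : ℕ) < bsize l ι f k := lt_of_le_of_lt hij hj
    rw [restr_apply f A k i hi, restr_apply f A k j hj]
    exact blk_antitone f hA k hij
  · rw [restr_zero f A k j hj]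
    exact Nat.zero_le _

lemma weyl_sum {l : ℕ} {B C A : Fin l → ℕ} (hB : Antitone B) (hC : Antitone C)
    (h : lrCoeff l B C A ≠ 0) :
    ∑ i, (A i : ℤ) = ∑ i, (B i : ℤ) + ∑ i, (C i : ℤ) := by
  have h1 := weyl hB hC h (w := fun _ => 1) (fun _ _ _ => le_rfl)
  have h2 := weyl hB hC h (w := fun _ => -1) (fun _ _ _ => le_rfl)
  simp only [one_mul, neg_mul, Finset.sum_neg_distrib] at h1 h2
  omega

lemma lr_restr {l ι : ℕ} (f : Fin l → Fin ι) {B C A : Fin l → ℕ}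
    (hB : Antitone B) (hC : Antitone C) (k : Fin ι)
    (h : 0 < lrCoeff l (restr l ι f B k) (restr l ι f C k) (restr l ι f A k)) :
    0 < lrCoeff _ (blk f B k) (blk f C k) (blk f A k) := by
  have hs := weyl_sum (restr_antitone f hB k) (restr_antitone f hC k) h.ne'
  have hbl : bsize l ι f k ≤ l := (Nat.le_add_left _ _).trans (bend_le f k)
  set b := bsize l ι f k with hb
  let g : Fin l → Fin 2 := fun i => if (i : ℕ) < b then 0 else 1
  have hg : Monotone g := by
    intro i j hij
    have : (i : ℕ) ≤ j := hij
    simp only [g]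
    split_ifs with h1 h2
    · exact le_rfl
    · exact Fin.zero_le _
    · omega
    · exact le_rfl
  have hs0 : bstart l 2 g 0 = 0 := by
    simp [bstart]
  have hb0 : bsize l 2 g 0 = b := by
    have : (univ.filter fun i => g i = 0) = univ.filter fun i : Fin l => (i : ℕ) < b := by
      ext i
      simp [g]
    rw [bsize, this, Fin.card_filter_val_lt]
    omega
  have hs1 : bstart l 2 g 1 = b := by
    have : (univ.filter fun i => g i < 1) = univ.filter fun i : Fin l => (i : ℕ) < b := by
      ext i
      simp only [g, Finset.mem_filter, mem_univ, true_and]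
      split_ifs with h <;> simp [h]
    rw [bstart, this, Fin.card_filter_val_lt]
    omega
  have hz : ∀ (D : Fin l → ℕ) (i : Fin l),
      -((g i : ℕ) : ℤ) * (restr l ι f D k i : ℤ) = 0 := by
    intro D i
    by_cases hi : (i : ℕ) < b
    · simp [g, hi]
    · rw [restr_zero f D k i hi]
      simp
  have hfac := lr_factor hg (restr_antitone f hB k) (restr_antitone f hC k)
    (A := restr l ι f A k) (by simp only [hz]; simp)
  rw [Fin.prod_univ_two] at hfac
  have e1 : ∀ (D : Fin l → ℕ) (i : Fin (bsize l 2 g 1)), blk g (restr l ι f D k) 1 i = 0 := by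
    intro D i
    rw [blk, restr_zero]
    simp only [bmap, hs1]
    omega
  have e0 : ∀ (D : Fin l → ℕ) (i : Fin (bsize l 2 g 0)),
      blk g (restr l ι f D k) 0 i = blk f D k (Fin.cast hb0 i) := by
    intro D i
    have hi : (bmap g 0 i : ℕ) = i := by simp [bmap, hs0]
    have := i.2
    rw [blk, restr_apply f D k _ (by omega)]
    congr 1
    apply Fin.ext
    exact hi
  rw [lrCoeff_congr hb0 (e0 B) (e0 C) (e0 A),
    lrCoeff_congr rfl (B' := fun _ => 0) (C' := fun _ => 0) (A' := fun _ => 0)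
      (e1 B) (e1 C) (e1 A), lrCoeff_zero, mul_one] at hfac
  rw [← hfac]
  exact h

lemma weyl_first {b : ℕ} {B C A : Fin b → ℕ} (hB : Antitone B) (hC : Antitone C)
    (h : lrCoeff b B C A ≠ 0) (hb : 0 < b) : A ⟨0, hb⟩ ≤ B ⟨0, hb⟩ + C ⟨0, hb⟩ := by
  have h1 := weyl hB hC h (w := fun i => if i = ⟨0, hb⟩ then 1 else 0) (by
    intro i j hij
    have hij' : (i : ℕ) ≤ j := hij
    simp only [Fin.ext_iff]
    split_ifs <;> omega)
  simp at h1
  omega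

lemma weyl_last {b : ℕ} {B C A : Fin b → ℕ} (hB : Antitone B) (hC : Antitone C)
    (h : lrCoeff b B C A ≠ 0) (hb : b - 1 < b) :
    B ⟨b - 1, hb⟩ + C ⟨b - 1, hb⟩ ≤ A ⟨b - 1, hb⟩ := by
  have h1 := weyl hB hC h (w := fun i => if i = ⟨b - 1, hb⟩ then -1 else 0) (by
    intro i j hij
    have hij' : (i : ℕ) ≤ j := hij
    have := j.2
    simp only [Fin.ext_iff]
    split_ifs <;> omega)
  simp at h1
  omega

lemma blk_antitone_of_restr {l ι : ℕ} (f : Fin l → Fin ι) {A : Fin l → ℕ} (k : Fin ι)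
    (h : Antitone (restr l ι f A k)) : Antitone (blk f A k) := by
  intro i j hij
  have hb := bend_le f k
  have hi := i.2
  have hj := j.2
  have := @h ⟨i, by omega⟩ ⟨j, by omega⟩ hij
  rwa [restr_apply f A k ⟨i, _⟩ hi, restr_apply f A k ⟨j, _⟩ hj] at this

/-- Let `f` encode a subdivision of `{1,…,l}` into consecutive
intervals `I_1,…,I_ι` and let `B`, `C` be partitions of length at most `l`. Suppose
`A : Fin l → ℕ` is such that each block restriction `A[I_j]` is a partition (of length at
most `|I_j|`) with positive Littlewood–Richardson coefficient `c^{A[I_j]}_{B[I_j],C[I_j]}`.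
Then the concatenation `A = A[I_1] ∘ ⋯ ∘ A[I_ι]` is a partition and `c^{A}_{B,C} > 0`. -/
theorem lrCoeff_pos_of_blocks (l ι : ℕ) (hl : 0 < l) (f : Fin l → Fin ι)
    (hf : Monotone f) (hsurj : Function.Surjective f)
    (B C : Fin l → ℕ) (hB : Antitone B) (hC : Antitone C)
    (A : Fin l → ℕ)
    (hAblocks : ∀ j : Fin ι, Antitone (restr l ι f A j))
    (hlr : ∀ j : Fin ι,
      0 < lrCoeff l (restr l ι f B j) (restr l ι f C j) (restr l ι f A j)) :
    Antitone A ∧ 0 < lrCoeff l B C A := by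
  have hpos : ∀ k, 0 < lrCoeff _ (blk f B k) (blk f C k) (blk f A k) :=
    fun k => lr_restr f hB hC k (hlr k)
  have hanti : ∀ k, Antitone (blk f A k) := fun k => blk_antitone_of_restr f k (hAblocks k)
  constructor
  · intro i j hij
    obtain ⟨⟨k, i⟩, rfl⟩ := (ball hf).surjective i
    obtain ⟨⟨k', j⟩, rfl⟩ := (ball hf).surjective j
    rw [ball_apply, ball_apply] at *
    have hkk : k ≤ k' := by
      have := hf hij
      rwa [f_bmap hf, f_bmap hf] at this
    rcases hkk.eq_or_lt with rfl | hlt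
    · refine hanti k ?_
      have : bstart l ι f k + (i : ℕ) ≤ bstart l ι f k + j := hij
      change (i : ℕ) ≤ j
      omega
    · have hi := i.2
      have hj := j.2
      have hb : bsize l ι f k - 1 < bsize l ι f k := by omega
      have hb' : 0 < bsize l ι f k' := by omega
      have h1 := weyl_last (blk_antitone f hB k) (blk_antitone f hC k) (hpos k).ne' hb
      have h2 := weyl_first (blk_antitone f hB k') (blk_antitone f hC k') (hpos k').ne' hb'
      have h3 : blk f A k ⟨_, hb⟩ ≤ blk f A k i := hanti k (by
        change (i : ℕ) ≤ bsize l ι f k - 1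
        omega)
      have h4 : blk f A k' j ≤ blk f A k' ⟨0, hb'⟩ := hanti k' (by
        change 0 ≤ (j : ℕ)
        omega)
      have h5 : bmap f k ⟨_, hb⟩ ≤ bmap f k' ⟨0, hb'⟩ := by
        by_contra hcon
        push Not at hcon
        have := hf hcon.le
        rw [f_bmap hf, f_bmap hf] at this
        exact absurd hlt (not_lt.2 this)
      have h6 : blk f B k' ⟨0, hb'⟩ ≤ blk f B k ⟨_, hb⟩ := hB h5
      have h7 : blk f C k' ⟨0, hb'⟩ ≤ blk f C k ⟨_, hb⟩ := hC h5
      change blk f A k' j ≤ blk f A k i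
      omega
  · rw [lr_factor hf hB hC]
    · exact Finset.prod_pos fun k _ => hpos k
    · rw [sum_blocks hf, sum_blocks hf, sum_blocks hf, ← Finset.sum_add_distrib]
      refine Finset.sum_congr rfl fun k _ => ?_
      simp only [f_bmap hf]
      rw [← Finset.mul_sum, ← Finset.mul_sum, ← Finset.mul_sum, ← mul_add]
      congr 1
      exact weyl_sum (blk_antitone f hB k) (blk_antitone f hC k) (hpos k).ne'
end

section
/- For all positive integers n and l there exists a positive integer N₀ such that for every N ≥ N₀ and every partition B of length at most l and weight Nn, the coefficient of the Schur polynomial s_B (in l variables) in the N-th power (h_n)^N of the complete homogeneous symmetric polynomial h_n is positive; equivalently, every Schur functor of weight Nn and at most l rows occurs in the N-th tensor power of the n-th symmetric power. -/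
open Finset MvPolynomial

theorem prod_map_X_eq {l : ℕ} (s : Multiset (Fin l)) :
    (s.map (X : Fin l → MvPolynomial (Fin l) ℤ)).prod = monomial (Multiset.toFinsupp s) 1 := by
  induction s using Multiset.induction_on with
  | empty => simp
  | cons a s ih =>
    rw [Multiset.map_cons, Multiset.prod_cons, ih, ← Multiset.singleton_add, Multiset.toFinsupp_add,
      Multiset.toFinsupp_singleton, X, monomial_mul, one_mul]

theorem coeff_hsymm_eq {l : ℕ} (n : ℕ) (d : Fin l →₀ ℕ) :
    coeff d (hsymm (Fin l) ℤ n) = if ∑ i, d i = n then 1 else 0 := by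
  classical
  have hcard : Multiset.card (Finsupp.toMultiset d) = ∑ i, d i := by
    rw [Finsupp.card_toMultiset, Finsupp.sum_fintype]
    · rfl
    · simp
  simp only [hsymm, coeff_sum, prod_map_X_eq, coeff_monomial, Multiset.toFinsupp_eq_iff]
  split_ifs with h
  · refine (Finset.sum_eq_single
      (⟨Finsupp.toMultiset d, by rw [hcard, h]⟩ : Sym (Fin l) n) ?_ ?_).trans ?_
    · intro b _ hb
      rw [if_neg]
      intro h'
      exact hb (Subtype.ext h')
    · exact fun h' => absurd (Finset.mem_univ (α := Sym (Fin l) n) _) h'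
    · simp
  · apply Finset.sum_eq_zero
    intro b _
    rw [if_neg]
    intro h'
    apply h
    rw [← hcard, ← h']
    exact b.2

theorem rename_vdm {l : ℕ} (σ : Equiv.Perm (Fin l)) :
    rename σ (vdm l) = (Equiv.Perm.sign σ : ℤ) • vdm l := by
  unfold vdm
  rw [AlgHom.map_det]
  have := Matrix.det_permute σ
    (Matrix.of fun i j : Fin l => (X i : MvPolynomial (Fin l) ℤ) ^ (l - 1 - (j : ℕ)))
  rw [zsmul_eq_mul]
  rw [← this]
  congr 1
  ext1 i j
  simp [Matrix.submatrix]

/-- Alternating polynomials, in terms of coefficients. -/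
def Alt {l : ℕ} (Q : MvPolynomial (Fin l) ℤ) : Prop :=
  ∀ (i j : Fin l) (g : Fin l →₀ ℕ), i ≠ j →
    coeff (g.mapDomain (Equiv.swap i j)) Q = - coeff g Q

theorem alt_pow {l : ℕ} (n N : ℕ) : Alt ((hsymm (Fin l) ℤ n) ^ N * vdm l) := by
  intro i j g hij
  have h : rename (Equiv.swap i j) ((hsymm (Fin l) ℤ n) ^ N * vdm l)
      = - ((hsymm (Fin l) ℤ n) ^ N * vdm l) := by
    rw [map_mul, map_pow, rename_hsymm, rename_vdm, Equiv.Perm.sign_swap hij]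
    simp
  have h2 := coeff_rename_mapDomain (Equiv.swap i j) (Equiv.swap i j).injective
    ((hsymm (Fin l) ℤ n) ^ N * vdm l) g
  rw [h, coeff_neg] at h2
  linarith

theorem coeff_vdm {l : ℕ} (g : Fin l →₀ ℕ) : coeff g (vdm l) =
    ∑ σ : Equiv.Perm (Fin l), (Equiv.Perm.sign σ : ℤ) *
      if (∀ i, g (σ i) = l - 1 - (i : ℕ)) then 1 else 0 := by
  classical
  unfold vdm
  rw [Matrix.det_apply, coeff_sum]
  refine Finset.sum_congr rfl fun σ _ => ?_
  rw [Units.smul_def, coeff_smul, smul_eq_mul]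
  congr 1
  simp only [Matrix.of_apply]
  have : ∏ i, (X (σ i) : MvPolynomial (Fin l) ℤ) ^ (l - 1 - (i : ℕ))
      = ∏ i, (X i) ^ (l - 1 - ((σ.symm i : Fin l) : ℕ)) := by
    rw [← Equiv.prod_comp σ
      (fun i => (X i : MvPolynomial (Fin l) ℤ) ^ (l - 1 - ((σ.symm i : Fin l) : ℕ)))]
    simp
  rw [this, coeff_prod_X_pow]
  congr 1
  rw [eq_iff_iff, Finsupp.ext_iff, ← σ.forall_congr_right]
  simp

theorem coeff_vdm_nonneg {l : ℕ} (g : Fin l →₀ ℕ) (hg : StrictAnti g) : 0 ≤ coeff g (vdm l) := by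
  rw [coeff_vdm]
  refine Finset.sum_nonneg fun σ _ => ?_
  split_ifs with h
  · have hm : StrictMono σ := by
      intro i j hij
      rw [← hg.lt_iff_gt, h, h]
      have := j.2
      have : (i : ℕ) < j := hij
      omega
    have : σ = 1 := by
      have h1 := Subsingleton.elim (hm.orderIsoOfSurjective σ σ.surjective) (OrderIso.refl _)
      ext i
      have := congrArg (fun e : Fin l ≃o Fin l => e i) h1
      simpa using congrArg Fin.val this
    simp [this]
  · simp

theorem coeff_vdm_delta {l : ℕ} (g : Fin l →₀ ℕ) (hg : ∀ i, g i = l - 1 - (i : ℕ)) :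
    coeff g (vdm l) = 1 := by
  rw [coeff_vdm, Finset.sum_eq_single 1]
  · simp [hg]
  · intro σ _ hσ
    rw [if_neg, mul_zero]
    intro h
    apply hσ
    ext i
    have := h i
    rw [hg] at this
    have := i.2
    have := (σ i).2
    simp only [Equiv.Perm.coe_one, id]
    omega
  · simp

/-- The index `i` violates the horizontal strip condition. -/
def Bad {l : ℕ} (β g : Fin l →₀ ℕ) (i : ℕ) : Prop :=
  ∃ h : i + 1 < l, g ⟨i, by omega⟩ ≤ β ⟨i + 1, h⟩

/-- Swap of adjacent entries. -/
noncomputable def adj {l : ℕ} (i : ℕ) (g : Fin l →₀ ℕ) : Fin l →₀ ℕ :=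
  if h : i + 1 < l then g.mapDomain (Equiv.swap ⟨i, by omega⟩ ⟨i + 1, h⟩) else g

theorem adj_apply {l : ℕ} (i : ℕ) (h : i + 1 < l) (g : Fin l →₀ ℕ) (j : Fin l) :
    adj i g j = g (Equiv.swap ⟨i, by omega⟩ ⟨i + 1, h⟩ j) := by
  rw [adj, dif_pos h, Finsupp.mapDomain_equiv_apply, Equiv.symm_swap]

theorem adj_adj {l : ℕ} (i : ℕ) (g : Fin l →₀ ℕ) : adj i (adj i g) = g := by
  by_cases h : i + 1 < l
  · ext j
    rw [adj_apply i h, adj_apply i h, Equiv.swap_apply_self]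
  · simp [adj, h]

open Classical in
/-- First bad index. -/
noncomputable def fb {l : ℕ} (β g : Fin l →₀ ℕ) : ℕ := if h : ∃ i, Bad β g i then Nat.find h else 0

theorem fb_bad {l : ℕ} {β g : Fin l →₀ ℕ} (h : ∃ i, Bad β g i) : Bad β g (fb β g) := by
  classical
  rw [fb, dif_pos h]; exact Nat.find_spec h

theorem fb_min {l : ℕ} {β g : Fin l →₀ ℕ} {j : ℕ} (hj : j < fb β g) : ¬ Bad β g j := by
  classical
  by_cases h : ∃ i, Bad β g i
  · rw [fb, dif_pos h] at hj; exact Nat.find_min h hj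
  · exact fun h' => h ⟨j, h'⟩

theorem fb_eq {l : ℕ} {β g : Fin l →₀ ℕ} {i : ℕ} (h : Bad β g i) (h' : ∀ j < i, ¬ Bad β g j) :
    fb β g = i := by
  rcases lt_trichotomy (fb β g) i with h1 | h1 | h1
  · exact absurd (fb_bad ⟨i, h⟩) (h' _ h1)
  · exact h1
  · exact absurd h (fb_min h1)

theorem pieri_step {l : ℕ} {β g : Fin l →₀ ℕ} (hβ : StrictAnti β) (hle : g ≤ β)
    (h : ∃ i, Bad β g i) :
    adj (fb β g) g ≤ β ∧ Bad β (adj (fb β g) g) (fb β g) ∧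
      fb β (adj (fb β g) g) = fb β g := by
  obtain ⟨hi, hb⟩ := fb_bad h
  set i := fb β g with hi0
  have hmin : ∀ j < i, ¬ Bad β g j := fun j hj => fb_min hj
  have hbad : Bad β (adj i g) i := by
    refine ⟨hi, ?_⟩
    rw [adj_apply i hi, Equiv.swap_apply_left]
    exact hle _
  refine ⟨?_, hbad, fb_eq hbad ?_⟩
  · intro j
    rw [adj_apply i hi]
    by_cases h1 : j = ⟨i, by omega⟩
    · subst h1
      rw [Equiv.swap_apply_left]
      refine (hle _).trans (hβ ?_).le
      simp [Fin.lt_def]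
    by_cases h2 : j = ⟨i + 1, hi⟩
    · subst h2
      rw [Equiv.swap_apply_right]
      exact hb
    rw [Equiv.swap_apply_of_ne_of_ne h1 h2]
    exact hle _
  · rintro j hj ⟨h1, h2⟩
    apply hmin j hj
    refine ⟨h1, ?_⟩
    rw [adj_apply i hi, Equiv.swap_apply_of_ne_of_ne] at h2
    · exact h2
    · simp [Fin.ext_iff]; omega
    · simp [Fin.ext_iff]; omega

theorem sum_adj {l : ℕ} (i : ℕ) (g : Fin l →₀ ℕ) : ∑ j, adj i g j = ∑ j, g j := by
  by_cases h : i + 1 < l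
  · simp only [adj_apply i h]
    exact Equiv.sum_comp (Equiv.swap _ _) (fun j => g j)
  · simp [adj, h]

open Classical in
theorem pieri_s17 {l : ℕ} (n : ℕ) (Q : MvPolynomial (Fin l) ℤ) (hQ : Alt Q) (β : Fin l →₀ ℕ)
    (hβ : StrictAnti β) :
    coeff β (hsymm (Fin l) ℤ n * Q) =
      ∑ p ∈ (Finset.HasAntidiagonal.antidiagonal β).filter (fun p => ¬ ∃ i, Bad β p.2 i),
        (if ∑ i, p.1 i = n then 1 else 0) * coeff p.2 Q := by
  rw [coeff_mul]
  simp only [coeff_hsymm_eq]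
  rw [← Finset.sum_filter_add_sum_filter_not (Finset.HasAntidiagonal.antidiagonal β) (fun p => ∃ i, Bad β p.2 i)]
  rw [add_eq_right]
  have key : ∀ g : Fin l →₀ ℕ, g ≤ β → (∃ i, Bad β g i) →
      coeff (adj (fb β g) g) Q = - coeff g Q := by
    intro g _ hb
    obtain ⟨hi, _⟩ := fb_bad hb
    rw [adj, dif_pos hi]
    apply hQ
    simp [Fin.ext_iff]
  have hsub : ∀ a b : Fin l →₀ ℕ, a + b = β → a = β - b := by
    intro a b h
    rw [← h, add_tsub_cancel_right]
  refine Finset.sum_involution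
    (fun p _ => (β - adj (fb β p.2) p.2, adj (fb β p.2) p.2)) ?_ ?_ ?_ ?_
  · rintro ⟨a, g⟩ hp
    simp only [Finset.mem_filter, Finset.HasAntidiagonal.mem_antidiagonal] at hp
    obtain ⟨h1, h2⟩ := hp
    have hle : g ≤ β := by rw [← h1]; exact le_add_self
    obtain ⟨h3, h4, h5⟩ := pieri_step hβ hle h2
    have hs : ∑ i, (β - adj (fb β g) g) i = ∑ i, a i := by
      have e1 : ∑ i, (β - adj (fb β g) g) i + ∑ i, adj (fb β g) g i = ∑ i, β i := by
        rw [← Finset.sum_add_distrib]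
        refine Finset.sum_congr rfl fun i _ => ?_
        have := h3 i
        rw [Finsupp.tsub_apply]
        omega
      have e2 : ∑ i, a i + ∑ i, g i = ∑ i, β i := by
        rw [← Finset.sum_add_distrib, ← h1]
        rfl
      rw [sum_adj] at e1
      omega
    simp only
    rw [hs, key g hle h2]
    ring
  · rintro ⟨a, g⟩ hp hne heq
    simp only [Finset.mem_filter, Finset.HasAntidiagonal.mem_antidiagonal] at hp
    obtain ⟨h1, h2⟩ := hp
    have hle : g ≤ β := by rw [← h1]; exact le_add_self
    have h3 := key g hle h2
    have h4 : adj (fb β g) g = g := congrArg Prod.snd heq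
    rw [h4] at h3
    apply hne
    have : coeff g Q = 0 := by linarith
    simp [this]
  · rintro ⟨a, g⟩ hp
    simp only [Finset.mem_filter, Finset.HasAntidiagonal.mem_antidiagonal] at hp ⊢
    obtain ⟨h1, h2⟩ := hp
    have hle : g ≤ β := by rw [← h1]; exact le_add_self
    obtain ⟨h3, h4, h5⟩ := pieri_step hβ hle h2
    exact ⟨tsub_add_cancel_of_le h3, _, h4⟩
  · rintro ⟨a, g⟩ hp
    simp only [Finset.mem_filter, Finset.HasAntidiagonal.mem_antidiagonal] at hp
    obtain ⟨h1, h2⟩ := hp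
    have hle : g ≤ β := by rw [← h1]; exact le_add_self
    obtain ⟨h3, h4, h5⟩ := pieri_step hβ hle h2
    simp only
    rw [h5, adj_adj, hsub a g h1]

/-- The exponent `b + δ`. -/
noncomputable def shifted (l : ℕ) (b : ℕ → ℕ) : Fin l →₀ ℕ :=
  Finsupp.equivFunOnFinite.symm fun i : Fin l => b i + (l - 1 - (i : ℕ))

theorem shifted_apply (l : ℕ) (b : ℕ → ℕ) (i : Fin l) :
    shifted l b i = b i + (l - 1 - (i : ℕ)) := rfl

theorem shifted_strictAnti (l : ℕ) (b : ℕ → ℕ) (hb : Antitone b) : StrictAnti (shifted l b) := by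
  intro i j hij
  rw [shifted_apply, shifted_apply]
  have h1 : (i : ℕ) < j := hij
  have h2 := hb h1.le
  have h3 := j.2
  omega

theorem strictAnti_of_good {l : ℕ} {β g : Fin l →₀ ℕ} (hβ : StrictAnti β) (hle : g ≤ β)
    (h : ¬ ∃ i, Bad β g i) : StrictAnti g := by
  intro i j hij
  have h1 : (i : ℕ) < j := hij
  have h2 := j.2
  by_contra h3
  apply h
  refine ⟨i, by omega, ?_⟩
  refine (not_lt.1 h3).trans ((hle j).trans (hβ.antitone ?_))
  rw [Fin.le_def]
  exact h1

theorem main_nonneg (n l : ℕ) (N : ℕ) : ∀ g : Fin l →₀ ℕ, StrictAnti g →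
    0 ≤ coeff g ((hsymm (Fin l) ℤ n) ^ N * vdm l) := by
  classical
  induction N with
  | zero =>
    intro g hg
    simpa using coeff_vdm_nonneg g hg
  | succ N ih =>
    intro g hg
    rw [pow_succ', mul_assoc, pieri_s17 n _ (alt_pow n N) g hg]
    refine Finset.sum_nonneg fun p hp => ?_
    simp only [Finset.mem_filter, Finset.HasAntidiagonal.mem_antidiagonal] at hp
    refine mul_nonneg (by split_ifs <;> simp) (ih _ (strictAnti_of_good hg ?_ hp.2))
    rw [← hp.1]
    exact le_add_self

theorem main_pos (n l : ℕ) (N : ℕ) : ∀ b : ℕ → ℕ, Antitone b →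
    (∀ i, l ≤ i → b i = 0) → ∑ i ∈ Finset.range l, b i = N * n →
    (∀ r, min r N * n ≤ ∑ i ∈ Finset.range r, b i) →
    0 < coeff (shifted l b) ((hsymm (Fin l) ℤ n) ^ N * vdm l) := by
  classical
  induction N with
  | zero =>
    intro b hb _ hs _
    rw [zero_mul, Finset.sum_eq_zero_iff] at hs
    rw [pow_zero, one_mul, coeff_vdm_delta]
    · exact one_pos
    · intro i
      rw [shifted_apply, hs i (Finset.mem_range.2 i.2), zero_add]
  | succ N ih =>
    intro b hb hz hs hd
    have hsa := shifted_strictAnti l b hb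
    have hb0 : n ≤ b 0 := by
      have := hd 1
      simpa using this
    let a : ℕ → ℕ := fun i => (b i - n) + min (b (i + 1)) n
    have hai : ∀ i, a i = (b i - n) + min (b (i + 1)) n := fun i => rfl
    have hanti : ∀ i, b (i + 1) ≤ b i := fun i => hb (Nat.le_succ i)
    have htel : ∀ r, ∑ i ∈ Finset.range r, a i + n = ∑ i ∈ Finset.range r, b i + min (b r) n := by
      intro r
      induction r with
      | zero => simp [hb0]
      | succ r ihr =>
        rw [Finset.sum_range_succ, Finset.sum_range_succ, hai]
        omega
    have haleb : ∀ i, a i ≤ b i := by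
      intro i; have := hanti i; rw [hai]; omega
    have hblea : ∀ i, b (i + 1) ≤ a i := by
      intro i; have := hanti i; rw [hai]; omega
    have hsum : ∑ i ∈ Finset.range l, a i = N * n := by
      have := htel l
      rw [hs, hz l le_rfl, add_mul] at this
      simp at this
      exact this
    have hpos := ih a (antitone_nat_of_succ_le fun i => (haleb (i + 1)).trans (hblea i))
      (fun i hi => Nat.le_zero.1 ((haleb i).trans (hz i hi).le)) hsum (by
        intro r
        have h1 := htel r
        rcases le_total (b r) n with h | h
        · have h2 := hd (r + 1)
          rw [Finset.sum_range_succ] at h2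
          rw [min_eq_left h] at h1
          rw [Nat.add_min_add_right, add_mul] at h2
          omega
        · have h2 := hd r
          rw [min_eq_right h] at h1
          have h3 : min r N * n ≤ min r (N + 1) * n := Nat.mul_le_mul_right _ (by omega)
          omega)
    have hle : shifted l a ≤ shifted l b := by
      intro i
      rw [shifted_apply, shifted_apply]
      have := haleb i
      omega
    rw [pow_succ', mul_assoc, pieri_s17 n _ (alt_pow n N) _ hsa]
    refine Finset.sum_pos' (fun p hp => ?_) ⟨(shifted l b - shifted l a, shifted l a), ?_, ?_⟩
    · simp only [Finset.mem_filter, Finset.HasAntidiagonal.mem_antidiagonal] at hp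
      refine mul_nonneg (by split_ifs <;> simp)
        (main_nonneg n l N _ (strictAnti_of_good hsa ?_ hp.2))
      rw [← hp.1]
      exact le_add_self
    · simp only [Finset.mem_filter, Finset.HasAntidiagonal.mem_antidiagonal]
      refine ⟨tsub_add_cancel_of_le hle, ?_⟩
      rintro ⟨i, hi, h⟩
      rw [shifted_apply, shifted_apply] at h
      have := hblea i
      simp only at h
      omega
    · simp only
      rw [if_pos, one_mul]
      · exact hpos
      · have e : ∑ i, (shifted l b - shifted l a) i + ∑ i ∈ Finset.range l, a i
            = ∑ i ∈ Finset.range l, b i := by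
          rw [← Fin.sum_univ_eq_sum_range, ← Fin.sum_univ_eq_sum_range, ← Finset.sum_add_distrib]
          refine Finset.sum_congr rfl fun i _ => ?_
          rw [Finsupp.tsub_apply, shifted_apply, shifted_apply]
          have := haleb i
          omega
        rw [hs, hsum, add_mul] at e
        omega

/-- For all positive integers `n` and `l` there is `N₀ > 0` such that
for every `N ≥ N₀`, every partition `B` of length at most `l` and weight `N·n` has
positive coefficient in the Schur expansion of `(h_n)^N` in `l` variables; equivalently,
every Schur functor of weight `N·n` with at most `l` rows occurs in the `N`-th tensor
power of the `n`-th symmetric power. -/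
theorem hsymm_power_contains_all (n l : ℕ) (hn : 0 < n) (hl : 0 < l) :
    ∃ N₀ : ℕ, 0 < N₀ ∧ ∀ N : ℕ, N₀ ≤ N → ∀ B : Fin l → ℕ, Antitone B →
      ∑ i, B i = N * n →
      0 < schurMult l B ((MvPolynomial.hsymm (Fin l) ℤ n) ^ N) := by
  refine ⟨l, hl, fun N hN B hB hs => ?_⟩
  let b : ℕ → ℕ := fun i => if h : i < l then B ⟨i, h⟩ else 0
  have hbB : ∀ i : Fin l, b i = B i := fun i => by simp [b]
  have hz : ∀ i, l ≤ i → b i = 0 := fun i hi => by simp [b, not_lt.2 hi]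
  have hb : Antitone b := by
    intro i j hij
    by_cases hj : j < l
    · have hi : i < l := by omega
      simp only [b, dif_pos hi, dif_pos hj]
      exact hB hij
    · rw [hz j (by omega)]
      exact Nat.zero_le _
  have hsum : ∑ i ∈ Finset.range l, b i = N * n := by
    rw [← Fin.sum_univ_eq_sum_range, ← hs]
    exact Finset.sum_congr rfl fun i _ => hbB i
  have key := main_pos n l N b hb hz hsum (by
    intro r
    rcases le_total l r with h | h
    · calc min r N * n ≤ N * n := Nat.mul_le_mul_right _ (min_le_right _ _)
        _ = ∑ i ∈ Finset.range l, b i := hsum.symm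
        _ ≤ ∑ i ∈ Finset.range r, b i :=
          Finset.sum_le_sum_of_subset (Finset.range_subset_range.2 h)
    · have hr : min r N * n ≤ r * n := Nat.mul_le_mul_right _ (min_le_left _ _)
      refine hr.trans ?_
      rcases le_total n (b r) with h1 | h1
      · have := Finset.card_nsmul_le_sum (Finset.range r) b n
          (fun i hi => h1.trans (hb (Finset.mem_range.1 hi).le))
        simpa using this
      · have h2 := Finset.sum_range_add_sum_Ico b h
        have h3 : ∑ i ∈ Finset.Ico r l, b i ≤ _ := Finset.sum_le_card_nsmul (Finset.Ico r l) b n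
          (fun i hi => (hb (Finset.mem_Ico.1 hi).1).trans h1)
        rw [Nat.card_Ico, smul_eq_mul] at h3
        have h4 : r * n + (l - r) * n ≤ N * n := by
          rw [← add_mul]
          exact Nat.mul_le_mul_right _ (by omega)
        omega)
  unfold schurMult
  convert key using 2
  ext i
  simp [shifted_apply, hbB]
end
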